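/- arXiv:2412.17642 — 5 statements merged into one kernel-verified Lean document; each statement's English description precedes it below -/
import Mathlib

section
/- Let G be a connected graph that is a path of k double-arborescences for some k ≥ 2, and suppose k is smallest possible, i.e., G is not a path of k' double-arborescences for any k' < k. Then G contains P4 (the path on four vertices) as an induced subgraph. -/
/-- A strict partial order (irreflexive and transitive relation). -/
def IsStrictPO {V : Type*} (lt : V → V → Prop) : Prop :=
  (∀ a, ¬ lt a a) ∧ ∀ a b c, lt a b → lt b c → lt a c

/-- `b` covers `a` in the strict order `lt`. -/
def CovRel {V : Type*} (lt : V → V → Prop) (a b : V) : Prop :=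
  lt a b ∧ ∀ c, lt a c → ¬ lt c b

/-- The Hasse diagram of a strict order: vertices joined iff one covers the other. -/
def hasseGraph {V : Type*} (lt : V → V → Prop) : SimpleGraph V :=
  SimpleGraph.fromRel (CovRel lt)

/-- `lt` is a treelike orientation of `G`: a transitive orientation
(a strict partial order in which distinct vertices are adjacent iff comparable)
whose Hasse diagram is a tree. -/
def IsTreelikeOrientation {V : Type*} (G : SimpleGraph V) (lt : V → V → Prop) : Prop :=
  IsStrictPO lt ∧ (∀ a b : V, G.Adj a b ↔ (lt a b ∨ lt b a)) ∧ (hasseGraph lt).IsTree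

/-- A treelike comparability graph: a graph admitting a treelike orientation. -/
def IsTreelikeComparability {V : Type*} (G : SimpleGraph V) : Prop :=
  ∃ lt : V → V → Prop, IsTreelikeOrientation G lt

/-- A double-arborescence: a treelike comparability graph with an all-adjacent vertex. -/
def IsDoubleArborescence {V : Type*} (G : SimpleGraph V) : Prop :=
  IsTreelikeComparability G ∧ ∃ r : V, ∀ v : V, v ≠ r → G.Adj r v

/-- An arborescence: a treelike comparability graph admitting a treelike orientation
in which some vertex is the greatest or the least element. -/
def IsArborescence {V : Type*} (G : SimpleGraph V) : Prop :=
  ∃ lt : V → V → Prop, IsTreelikeOrientation G lt ∧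
    ∃ r : V, (∀ v : V, v ≠ r → lt v r) ∨ (∀ v : V, v ≠ r → lt r v)

/-- `G` contains an induced path on four vertices. -/
def HasInducedP4 {V : Type*} (G : SimpleGraph V) : Prop :=
  ∃ a b c d : V, a ≠ b ∧ a ≠ c ∧ a ≠ d ∧ b ≠ c ∧ b ≠ d ∧ c ≠ d ∧
    G.Adj a b ∧ G.Adj b c ∧ G.Adj c d ∧ ¬ G.Adj a c ∧ ¬ G.Adj a d ∧ ¬ G.Adj b d

/-- `G` is `P4`-free. -/
def P4Free {V : Type*} (G : SimpleGraph V) : Prop := ¬ HasInducedP4 G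

/-- `G` contains an induced cycle on four vertices. -/
def HasInducedC4 {V : Type*} (G : SimpleGraph V) : Prop :=
  ∃ a b c d : V, a ≠ b ∧ a ≠ c ∧ a ≠ d ∧ b ≠ c ∧ b ≠ d ∧ c ≠ d ∧
    G.Adj a b ∧ G.Adj b c ∧ G.Adj c d ∧ G.Adj d a ∧ ¬ G.Adj a c ∧ ¬ G.Adj b d

/-- `G` is `C4`-free. -/
def C4Free {V : Type*} (G : SimpleGraph V) : Prop := ¬ HasInducedC4 G

/-- `G` is a path of `k` double-arborescences: it has a treelike orientation `lt`,
a partition of its vertex set into `k` parts with roots `r i`, such that each part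
induces a double-arborescence rooted at `r i` whose treelike orientation is the
restriction of `lt`, and the edges of the Hasse tree joining distinct parts are
exactly the path edges joining consecutive roots. -/
def IsPathOfDoubleArborescences {V : Type*} (G : SimpleGraph V) (k : ℕ) : Prop :=
  ∃ lt : V → V → Prop, IsTreelikeOrientation G lt ∧
    ∃ (P : Fin k → Set V) (r : Fin k → V),
      (∀ v : V, ∃! i : Fin k, v ∈ P i) ∧
      (∀ i : Fin k, r i ∈ P i) ∧
      (∀ i : Fin k, ∀ v ∈ P i, v ≠ r i → G.Adj (r i) v) ∧
      (∀ i : Fin k,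
        IsTreelikeOrientation (G.induce (P i)) (fun a b => lt a.1 b.1)) ∧
      (∀ i j : Fin k, i ≠ j → ∀ a ∈ P i, ∀ b ∈ P j,
        ((hasseGraph lt).Adj a b ↔
          (a = r i ∧ b = r j ∧ ((i : ℕ) + 1 = (j : ℕ) ∨ (j : ℕ) + 1 = (i : ℕ)))))

section StrictOrders

variable {V : Type*} {lt : V → V → Prop}

theorem IsStrictPO.swap (h : IsStrictPO lt) : IsStrictPO (Function.swap lt) :=
  ⟨h.1, fun a b c hab hbc => h.2 c b a hbc hab⟩

theorem hasseGraph_adj (h : IsStrictPO lt) {a b : V} :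
    (hasseGraph lt).Adj a b ↔ CovRel lt a b ∨ CovRel lt b a := by
  simp only [hasseGraph, SimpleGraph.fromRel_adj, ne_eq, and_iff_right_iff_imp]
  rintro (hc | hc) rfl <;> exact h.1 _ hc.1

theorem covRel_swap {a b : V} : CovRel (Function.swap lt) a b ↔ CovRel lt b a :=
  ⟨fun h => ⟨h.1, fun c h1 h2 => h.2 c h2 h1⟩, fun h => ⟨h.1, fun c h1 h2 => h.2 c h2 h1⟩⟩

theorem hasseGraph_swap : hasseGraph (Function.swap lt) = hasseGraph lt := by
  ext a b
  simp only [hasseGraph, SimpleGraph.fromRel_adj, covRel_swap, or_comm]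

/-- In a finite strict order, comparable elements are joined by a chain of covers. -/
theorem IsStrictPO.transGen_covRel [Finite V] (h : IsStrictPO lt) {a b : V} (hab : lt a b) :
    Relation.TransGen (CovRel lt) a b := by
  have : Std.Irrefl lt := ⟨h.1⟩
  have : IsTrans V lt := ⟨h.2⟩
  have wf : WellFounded lt := Finite.wellFounded_of_trans_of_irrefl lt
  have wf' : WellFounded (Function.swap lt) := Finite.wellFounded_of_trans_of_irrefl _
  induction b using wf.induction with
  | _ b ih =>
    by_cases hne : {c | lt a c ∧ lt c b}.Nonempty
    · obtain ⟨c, ⟨hac, hcb⟩, hmax⟩ := wf'.has_min _ hne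
      exact (ih c hcb hac).tail ⟨hcb, fun d hcd hdb => hmax d ⟨h.2 _ _ _ hac hcd, hdb⟩ hcd⟩
    · exact .single ⟨hab, fun c hac hcb => hne ⟨c, hac, hcb⟩⟩

theorem IsStrictPO.lt_of_transGen_covRel (h : IsStrictPO lt) {a b : V}
    (hab : Relation.TransGen (CovRel lt) a b) : lt a b := by
  induction hab with
  | single hc => exact hc.1
  | tail _ hc ih => exact h.2 _ _ _ ih hc.1

/-- A comparability between elements on different sides of a bipartition passes through a cover
across the bipartition. -/
theorem IsStrictPO.exists_covRel_crossing [Finite V] (h : IsStrictPO lt) {S : V → Prop} {a b : V}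
    (hab : lt a b) (ha : S a) (hb : ¬ S b) :
    ∃ x y, S x ∧ ¬ S y ∧ CovRel lt x y ∧ (a = x ∨ lt a x) ∧ (y = b ∨ lt y b) := by
  induction h.transGen_covRel hab using Relation.TransGen.head_induction_on with
  | single hc => exact ⟨_, _, ha, hb, hc, .inl rfl, .inl rfl⟩
  | @head a c hac hcb ih =>
    have hcb' : lt c b := h.lt_of_transGen_covRel hcb
    by_cases hc : S c
    · obtain ⟨x, y, hx, hy, hxy, hcx, hyb⟩ := ih hcb' hc
      refine ⟨x, y, hx, hy, hxy, .inr ?_, hyb⟩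
      rcases hcx with rfl | hcx
      exacts [hac.1, h.2 _ _ _ hac.1 hcx]
    · exact ⟨a, c, ha, hc, hac, .inl rfl, .inr hcb'⟩

theorem IsStrictPO.reachable_hasseGraph [Finite V] (h : IsStrictPO lt) {a b : V} (hab : lt a b) :
    (hasseGraph lt).Reachable a b := by
  induction h.transGen_covRel hab with
  | single hc => exact ((hasseGraph_adj h).2 (.inl hc)).reachable
  | tail _ hc ih =>
    exact (ih (h.lt_of_transGen_covRel (by assumption))).trans ((hasseGraph_adj h).2 (.inl hc)).reachable

end StrictOrders

theorem IsTreelikeOrientation.swap {V : Type*} {G : SimpleGraph V} {lt : V → V → Prop}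
    (h : IsTreelikeOrientation G lt) : IsTreelikeOrientation G (Function.swap lt) :=
  ⟨h.1.swap, fun a b => (h.2.1 a b).trans or_comm, hasseGraph_swap (lt := lt) ▸ h.2.2⟩

/-- A convex set with an element comparable to all its other elements inherits a treelike
orientation. -/
theorem IsTreelikeOrientation.induce {V : Type*} [Finite V] {G : SimpleGraph V}
    {lt : V → V → Prop} (h : IsTreelikeOrientation G lt) {S : Set V} {r : V} (hr : r ∈ S)
    (hroot : ∀ v ∈ S, v ≠ r → G.Adj r v)
    (hconv : ∀ a ∈ S, ∀ b ∈ S, ∀ c, lt a c → lt c b → c ∈ S) :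
    IsTreelikeOrientation (G.induce S) (fun a b => lt a.1 b.1) := by
  have hpo : IsStrictPO (fun a b : S => lt a.1 b.1) :=
    ⟨fun a => h.1.1 a.1, fun a b c => h.1.2 a.1 b.1 c.1⟩
  have hcov : ∀ a b : S, CovRel (fun a b : S => lt a.1 b.1) a b → CovRel lt a.1 b.1 :=
    fun a b hc => ⟨hc.1, fun c h1 h2 => hc.2 ⟨c, hconv _ a.2 _ b.2 c h1 h2⟩ h1 h2⟩
  refine ⟨hpo, fun a b => h.2.1 a.1 b.1, ?_, ?_⟩
  · have hreach : ∀ v : S, (hasseGraph fun a b : S => lt a.1 b.1).Reachable ⟨r, hr⟩ v := by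
      intro v
      by_cases hv : v.1 = r
      · rw [show v = ⟨r, hr⟩ from Subtype.ext hv]
      · rcases (h.2.1 _ _).1 (hroot v.1 v.2 hv) with hlt | hlt
        · exact hpo.reachable_hasseGraph (a := ⟨r, hr⟩) hlt
        · exact (hpo.reachable_hasseGraph (b := ⟨r, hr⟩) hlt).symm
    have : Nonempty S := ⟨⟨r, hr⟩⟩
    exact ⟨fun u v => (hreach u).symm.trans (hreach v)⟩
  · refine h.2.2.2.comap ⟨Subtype.val, fun {a b} hab => ?_⟩ Subtype.val_injective
    rw [hasseGraph_adj hpo] at hab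
    exact (hasseGraph_adj h.1).2 (hab.imp (hcov a b) (hcov b a))

/-- The combinatorial data of a path of `k` double-arborescences: `f` sends a vertex to the index
of its part and `r` an index to the root of the corresponding part. -/
structure IsRootedPathPartition {V : Type*} (G : SimpleGraph V) (lt : V → V → Prop) (k : ℕ)
    (f : V → ℕ) (r : ℕ → V) : Prop where
  index_lt : ∀ v, f v < k
  index_root : ∀ i < k, f (r i) = i
  root_adj : ∀ v, v ≠ r (f v) → G.Adj (r (f v)) v
  hasse_adj_iff : ∀ a b, f a ≠ f b → ((hasseGraph lt).Adj a b ↔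
    (a = r (f a) ∧ b = r (f b) ∧ (f a + 1 = f b ∨ f b + 1 = f a)))

theorem IsPathOfDoubleArborescences.exists_isRootedPathPartition {V : Type*} {G : SimpleGraph V}
    {k : ℕ} (hk : 0 < k) (h : IsPathOfDoubleArborescences G k) :
    ∃ lt f r, IsTreelikeOrientation G lt ∧ IsRootedPathPartition G lt k f r := by
  obtain ⟨lt, ht, P, r, hP, hr, hadj, -, hedge⟩ := h
  choose f hf huniq using hP
  refine ⟨lt, fun v => f v, fun i => if hi : i < k then r ⟨i, hi⟩ else r ⟨0, hk⟩, ht, ?_, ?_, ?_,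
    ?_⟩
  · exact fun v => (f v).2
  · intro i hi
    simp only [hi, dif_pos]
    rw [← huniq _ _ (hr ⟨i, hi⟩)]
  · intro v hv
    simp only [Fin.is_lt, dif_pos, Fin.eta] at hv ⊢
    exact hadj _ v (hf v) hv
  · intro a b hab
    simp only [Fin.is_lt, dif_pos, Fin.eta]
    exact hedge _ _ (fun h => hab (congrArg Fin.val h)) a (hf a) b (hf b)

namespace IsRootedPathPartition

variable {V : Type*} {G : SimpleGraph V} {lt : V → V → Prop} {k : ℕ} {f : V → ℕ} {r : ℕ → V}

theorem root_of_covRel (h : IsRootedPathPartition G lt k f r) (hpo : IsStrictPO lt) {a b : V}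
    (hc : CovRel lt a b) (hab : f a ≠ f b) :
    a = r (f a) ∧ b = r (f b) ∧ (f a + 1 = f b ∨ f b + 1 = f a) :=
  (h.hasse_adj_iff a b hab).1 ((hasseGraph_adj hpo).2 (.inl hc))

theorem isPathOfDoubleArborescences [Finite V] (h : IsRootedPathPartition G lt k f r)
    (ht : IsTreelikeOrientation G lt) : IsPathOfDoubleArborescences G k := by
  have hroot : ∀ i : Fin k, ∀ v, f v = i → v ≠ r i → G.Adj (r i) v := fun i v hv hne => by
    rw [← hv] at hne ⊢
    exact h.root_adj v hne
  refine ⟨lt, ht, fun i => {v | f v = i}, fun i => r i, ?_, ?_, hroot, ?_, ?_⟩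
  · exact fun v => ⟨⟨f v, h.index_lt v⟩, rfl, fun j hj => Fin.ext hj.symm⟩
  · exact fun i => h.index_root i i.2
  · intro i
    refine ht.induce (h.index_root i i.2) (hroot i) fun a ha b hb c hac hcb => ?_
    by_contra hc
    obtain ⟨x, y, hx, hy, hxy, -, hyc⟩ :=
      ht.1.exists_covRel_crossing (S := fun v => f v = i) hac ha hc
    obtain ⟨y', x', hy', hx', hyx', hcy', -⟩ :=
      ht.1.exists_covRel_crossing (S := fun v => f v ≠ i) hcb hc (not_not.2 hb)
    rw [not_not] at hx'
    have e := (h.root_of_covRel ht.1 hxy (by omega)).1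
    have e' := (h.root_of_covRel ht.1 hyx' (by omega)).2.1
    rw [hx] at e
    rw [hx', ← e] at e'
    subst e'
    have h1 : lt x' c := by
      rcases hyc with rfl | hyc
      exacts [hxy.1, ht.1.2 _ _ _ hxy.1 hyc]
    have h2 : lt c x' := by
      rcases hcy' with rfl | hcy'
      exacts [hyx'.1, ht.1.2 _ _ _ hcy' hyx'.1]
    exact ht.1.1 _ (ht.1.2 _ _ _ h1 h2)
  · intro i j hij a ha b hb
    simp only [Set.mem_ofPred_eq] at ha hb
    have := h.hasse_adj_iff a b (by rw [ha, hb]; exact fun e => hij (Fin.ext e))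
    rwa [ha, hb] at this

theorem swap (h : IsRootedPathPartition G lt k f r) :
    IsRootedPathPartition G (Function.swap lt) k f r where
  index_lt := h.index_lt
  index_root := h.index_root
  root_adj := h.root_adj
  hasse_adj_iff := by
    rw [hasseGraph_swap]
    exact h.hasse_adj_iff

theorem reverse (h : IsRootedPathPartition G lt k f r) :
    IsRootedPathPartition G lt k (fun v => k - 1 - f v) (fun i => r (k - 1 - i)) := by
  have hinv : ∀ v, k - 1 - (k - 1 - f v) = f v := fun v => by
    have := h.index_lt v
    omega
  refine ⟨fun v => ?_, fun i hi => ?_, fun v => ?_, fun a b hab => ?_⟩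
  · have := h.index_lt v
    omega
  · rw [h.index_root _ (by omega)]
    omega
  · simp only [hinv]
    exact h.root_adj v
  · have ha := h.index_lt a
    have hb := h.index_lt b
    simp only [hinv]
    rw [h.hasse_adj_iff a b (by omega)]
    have : (f a + 1 = f b ∨ f b + 1 = f a) ↔
      (k - 1 - f a + 1 = k - 1 - f b ∨ k - 1 - f b + 1 = k - 1 - f a) := by omega
    rw [this]

/-- If the first part lies below its root, and this root lies below the second one, then the first
part can be merged into the second. -/
theorem merge_first (h : IsRootedPathPartition G lt k f r) (ht : IsTreelikeOrientation G lt)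
    (hk : 2 ≤ k) (h01 : lt (r 0) (r 1)) (hlow : ∀ v, f v = 0 → ¬ lt (r 0) v) :
    IsRootedPathPartition G lt (k - 1) (fun v => f v - 1) (fun i => r (i + 1)) := by
  have h1 := h.index_root 1 (by omega)
  refine ⟨fun v => ?_, fun i hi => ?_, fun v hv => ?_, fun a b hab => ?_⟩
  · have := h.index_lt v
    omega
  · rw [h.index_root _ (by omega)]
    omega
  · by_cases hf : f v = 0
    · rw [hf] at hv ⊢
      refine (ht.2.1 _ _).2 (.inr ?_)
      by_cases hv0 : v = r 0
      · exact hv0 ▸ h01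
      · have hadj := h.root_adj v (by rwa [hf])
        rw [hf] at hadj
        exact ht.1.2 _ _ _ (((ht.2.1 _ _).1 hadj).resolve_left (hlow v hf)) h01
    · rw [Nat.sub_add_cancel (by omega)] at hv ⊢
      exact h.root_adj v hv
  · rw [h.hasse_adj_iff a b (fun e => hab (by rw [e]))]
    constructor
    · rintro ⟨ha, hb, hs⟩
      rw [Nat.sub_add_cancel (by omega), Nat.sub_add_cancel (by omega)]
      exact ⟨ha, hb, by omega⟩
    · rintro ⟨ha, hb, hs⟩
      have hfa : f a ≠ 0 := fun e => by
        rw [e] at ha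
        have : f a = 1 := (congrArg f ha).trans h1
        omega
      have hfb : f b ≠ 0 := fun e => by
        rw [e] at hb
        have : f b = 1 := (congrArg f hb).trans h1
        omega
      rw [Nat.sub_add_cancel (by omega)] at ha hb
      exact ⟨ha, hb, by omega⟩

/-- If the number of parts cannot be reduced by one and the first root lies below the second one,
then the first part has an element above its root, isolated from all other parts. -/
theorem exists_adj_root_zero [Finite V] (h : IsRootedPathPartition G lt k f r)
    (ht : IsTreelikeOrientation G lt) (hk : 2 ≤ k)
    (hmin : ¬ IsPathOfDoubleArborescences G (k - 1)) (h01 : lt (r 0) (r 1)) :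
    ∃ a, f a = 0 ∧ G.Adj a (r 0) ∧ ∀ v, f v ≠ 0 → ¬ G.Adj a v := by
  obtain ⟨a, ha, hlt⟩ : ∃ a, f a = 0 ∧ lt (r 0) a := by
    by_contra! hne
    exact hmin ((h.merge_first ht hk h01 hne).isPathOfDoubleArborescences ht)
  refine ⟨a, ha, (ht.2.1 _ _).2 (.inr hlt), fun v hv hadj => ?_⟩
  rcases (ht.2.1 _ _).1 hadj with hav | hva
  · obtain ⟨x, y, hx, hy, hxy, hax, -⟩ :=
      ht.1.exists_covRel_crossing (S := fun v => f v = 0) hav ha hv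
    have e := (h.root_of_covRel ht.1 hxy (by omega)).1
    rw [hx] at e
    subst e
    rcases hax with rfl | hax
    exacts [ht.1.1 _ hlt, ht.1.1 _ (ht.1.2 _ _ _ hlt hax)]
  · obtain ⟨y, x, hy, hx, hyx, -, -⟩ :=
      ht.1.exists_covRel_crossing (S := fun v => f v ≠ 0) hva hv (not_not.2 ha)
    rw [not_not] at hx
    obtain ⟨ey, ex, hs⟩ := h.root_of_covRel ht.1 hyx (by omega)
    have hy1 : f y = 1 := by omega
    rw [hy1] at ey
    rw [hx] at ex
    subst ey ex
    exact ht.1.1 _ (ht.1.2 _ _ _ hyx.1 h01)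

/-- If the root with index `m + 1` lies below the root with index `m`, then an element of the first
parts below the latter is incomparable to all elements of the parts beyond `m`. -/
theorem not_adj_of_lt_of_gt [Finite V] (h : IsRootedPathPartition G lt k f r)
    (ht : IsTreelikeOrientation G lt) {m : ℕ} (hm : lt (r (m + 1)) (r m)) {u v : V}
    (hum : lt u (r m)) (hu : f u ≤ m) (hv : m < f v) : ¬ G.Adj u v := by
  intro hadj
  rcases (ht.2.1 _ _).1 hadj with huv | hvu
  · obtain ⟨x, y, hx, hy, hxy, -, -⟩ :=
      ht.1.exists_covRel_crossing (S := fun v => f v ≤ m) huv hu (by omega)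
    obtain ⟨ex, ey, hs⟩ := h.root_of_covRel ht.1 hxy (by omega)
    rw [show f x = m by omega] at ex
    rw [show f y = m + 1 by omega] at ey
    subst ex ey
    exact ht.1.1 _ (ht.1.2 _ _ _ hxy.1 hm)
  · obtain ⟨y, x, hy, hx, hyx, -, hxu⟩ :=
      ht.1.exists_covRel_crossing (S := fun v => m < f v) hvu hv (by omega)
    obtain ⟨-, ex, hs⟩ := h.root_of_covRel ht.1 hyx (by omega)
    rw [show f x = m by omega] at ex
    subst ex
    rcases hxu with e | hxu
    · rw [e] at hum
      exact ht.1.1 _ hum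
    · exact ht.1.1 _ (ht.1.2 _ _ _ hxu hum)

end IsRootedPathPartition

theorem HasInducedP4.of_adj {V : Type*} {G : SimpleGraph V} {a b c d : V} (hab : G.Adj a b)
    (hbc : G.Adj b c) (hcd : G.Adj c d) (hac : ¬ G.Adj a c) (had : ¬ G.Adj a d)
    (hbd : ¬ G.Adj b d) : HasInducedP4 G := by
  refine ⟨a, b, c, d, hab.ne, ?_, ?_, hbc.ne, ?_, hcd.ne, hab, hbc, hcd, hac, had, hbd⟩
  · rintro rfl
    exact had hcd
  · rintro rfl
    exact hac hcd.symm
  · rintro rfl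
    exact had hab

theorem IsRootedPathPartition.hasInducedP4 {V : Type*} [Finite V] {G : SimpleGraph V}
    {lt : V → V → Prop} {k : ℕ} {f : V → ℕ} {r : ℕ → V}
    (h : IsRootedPathPartition G lt k f r) (ht : IsTreelikeOrientation G lt) (hk : 2 ≤ k)
    (hmin : ¬ IsPathOfDoubleArborescences G (k - 1)) (h01 : lt (r 0) (r 1)) :
    HasInducedP4 G := by
  obtain ⟨a, -, har, ha⟩ := h.exists_adj_root_zero ht hk hmin h01
  have chain : ∀ m, 0 < m → (∀ i < m, lt (r i) (r (i + 1))) → lt (r 0) (r m) := by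
    intro m hm hlt
    induction m, hm using Nat.le_induction with
    | base => exact h01
    | succ n hn ih =>
      exact ht.1.2 _ _ _ (ih fun i hi => hlt i (by omega)) (hlt n (by omega))
  by_cases hdir : ∀ i < k - 1, lt (r i) (r (i + 1))
  · have hlast := chain (k - 1) (by omega) hdir
    obtain ⟨b, hb0, hbr, hb⟩ := h.reverse.swap.exists_adj_root_zero ht.swap hk hmin (by
      have := hdir (k - 2) (by omega)
      rwa [show k - 2 + 1 = k - 1 by omega] at this)
    have hnonadj : ∀ v, f v ≠ k - 1 → ¬ G.Adj b v := fun v hv => hb v (by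
      have := h.index_lt v
      omega)
    refine .of_adj har ((ht.2.1 _ _).2 (.inl hlast)) hbr.symm
      (ha _ (by rw [h.index_root _ (by omega)]; omega)) (ha _ (by have := h.index_lt b; omega))
      fun hadj => hnonadj _ (by rw [h.index_root _ (by omega)]; omega) hadj.symm
  · push Not at hdir
    classical
    obtain ⟨hmk, hmn⟩ := Nat.find_spec hdir
    have hmlt := fun i (hi : i < Nat.find hdir) => Nat.find_min hdir hi
    set m := Nat.find hdir
    have hm0 : 0 < m := by
      rcases Nat.eq_zero_or_pos m with e | e
      · rw [e] at hmn
        exact absurd h01 hmn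
      · exact e
    have h0m : lt (r 0) (r m) := chain m hm0 fun i hi => by
      by_contra hne
      exact hmlt i hi ⟨by omega, hne⟩
    have fm := h.index_root m (by omega)
    have fm1 := h.index_root (m + 1) (by omega)
    have f0 := h.index_root 0 (by omega)
    have hdown : lt (r (m + 1)) (r m) := by
      have hadj := (h.hasse_adj_iff (r m) (r (m + 1)) (by omega)).2
        ⟨by rw [fm], by rw [fm1], by omega⟩
      rcases (hasseGraph_adj ht.1).1 hadj with hc | hc
      exacts [absurd hc.1 hmn, hc.1]
    exact .of_adj har ((ht.2.1 _ _).2 (.inl h0m)) ((ht.2.1 _ _).2 (.inr hdown))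
      (ha _ (by omega)) (ha _ (by omega))
      (h.not_adj_of_lt_of_gt ht hdown h0m (by omega) (by omega))

/-- If a connected graph `G` is a path of `k ≥ 2` double-arborescences, with `k`
smallest possible, then `G` contains `P4` as an induced subgraph. -/
theorem path_of_double_arborescences_has_induced_P4
    {V : Type*} [Fintype V] (G : SimpleGraph V) (hconn : G.Connected)
    (k : ℕ) (hk : 2 ≤ k) (hpath : IsPathOfDoubleArborescences G k)
    (hmin : ∀ k' : ℕ, k' < k → ¬ IsPathOfDoubleArborescences G k') :
    HasInducedP4 G := by
  have hmin' := hmin (k - 1) (by omega)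
  obtain ⟨lt, f, r, ht, h⟩ := hpath.exists_isRootedPathPartition (by omega)
  have f0 := h.index_root 0 (by omega)
  have f1 := h.index_root 1 (by omega)
  have hadj := (h.hasse_adj_iff (r 0) (r 1) (by omega)).2 ⟨by rw [f0], by rw [f1], by omega⟩
  rcases (hasseGraph_adj ht.1).1 hadj with hc | hc
  · exact h.hasInducedP4 ht hk hmin' hc.1
  · exact h.swap.hasInducedP4 ht.swap hk hmin' hc.1
end

section
/- A connected graph G is a double-arborescence if and only if G is a P4-free treelike comparability graph. -/
theorem SimpleGraph.Walk.IsPath.append_of_inter {V : Type*} {H : SimpleGraph V} {a b c : V}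
    {p : H.Walk a b} {q : H.Walk b c} (hp : p.IsPath) (hq : q.IsPath)
    (h : ∀ z ∈ p.support, z ∈ q.support → z = b) : (p.append q).IsPath := by
  rw [SimpleGraph.Walk.isPath_def, SimpleGraph.Walk.support_append, List.nodup_append]
  have hq' := hq.support_nodup
  rw [← q.cons_tail_support, List.nodup_cons] at hq'
  refine ⟨hp.support_nodup, hq'.2, ?_⟩
  rintro x hx y hy rfl
  exact hq'.1 (h x hx (List.mem_of_mem_tail hy) ▸ hy)

theorem IsStrictPO.wellFounded {V : Type*} [Finite V] {lt : V → V → Prop} (h : IsStrictPO lt) :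
    WellFounded lt :=
  have : Std.Irrefl lt := ⟨h.1⟩
  have : IsTrans V lt := ⟨h.2⟩
  Finite.wellFounded_of_trans_of_irrefl lt

theorem IsStrictPO.flip {V : Type*} {lt : V → V → Prop} (h : IsStrictPO lt) :
    IsStrictPO (flip lt) :=
  ⟨h.1, fun a b c hab hbc => h.2 c b a hbc hab⟩

theorem hasseGraph_flip {V : Type*} (lt : V → V → Prop) :
    hasseGraph (flip lt) = hasseGraph lt := by
  ext a b
  simp only [hasseGraph, SimpleGraph.fromRel_adj, CovRel, flip]
  grind

theorem IsTreelikeOrientation.flip {V : Type*} {G : SimpleGraph V} {lt : V → V → Prop}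
    (h : IsTreelikeOrientation G lt) : IsTreelikeOrientation G (flip lt) :=
  ⟨h.1.flip, fun a b => (h.2.1 a b).trans or_comm, (hasseGraph_flip lt).symm ▸ h.2.2⟩

/-- Comparable elements are joined in the Hasse diagram by a path inside their interval. -/
theorem IsStrictPO.exists_path_hasseGraph {V : Type*} [Finite V] {lt : V → V → Prop}
    (h : IsStrictPO lt) {a b : V} (hab : lt a b) :
    ∃ p : (hasseGraph lt).Walk a b, p.IsPath ∧
      ∀ x ∈ p.support, (x = a ∨ lt a x) ∧ (x = b ∨ lt x b) := by
  induction a using h.flip.wellFounded.induction with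
  | _ a ih =>
    obtain ⟨c, ⟨hac, hcb⟩, hmin⟩ :=
      h.wellFounded.has_min {c | lt a c ∧ (c = b ∨ lt c b)} ⟨b, hab, Or.inl rfl⟩
    have hadj : (hasseGraph lt).Adj a c := by
      rw [hasseGraph, SimpleGraph.fromRel_adj]
      refine ⟨fun e => h.1 a (e ▸ hac), Or.inl ⟨hac, fun d had hdc => hmin d ⟨had, ?_⟩ hdc⟩⟩
      rcases hcb with rfl | hcb
      · exact Or.inr hdc
      · exact Or.inr (h.2 _ _ _ hdc hcb)
    have key : ∃ p : (hasseGraph lt).Walk c b, p.IsPath ∧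
        ∀ x ∈ p.support, (x = c ∨ lt c x) ∧ (x = b ∨ lt x b) := by
      rcases hcb with rfl | hcb
      · exact ⟨.nil, .nil, by simp⟩
      · exact ih c hac hcb
    obtain ⟨p, hp, hps⟩ := key
    have hlt : ∀ x ∈ p.support, lt a x := fun x hx => by
      rcases (hps x hx).1 with rfl | hcx
      · exact hac
      · exact h.2 _ _ _ hac hcx
    refine ⟨.cons hadj p, hp.cons fun ha => h.1 a (hlt a ha), fun x hx => ?_⟩
    rw [SimpleGraph.Walk.support_cons, List.mem_cons] at hx
    rcases hx with rfl | hx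
    · exact ⟨Or.inl rfl, Or.inr hab⟩
    · exact ⟨Or.inr (hlt x hx), (hps x hx).2⟩

/-- Intervals of a strict order with acyclic Hasse diagram are chains. -/
theorem IsStrictPO.comparable_of_mem_interval {V : Type*} [Finite V] {lt : V → V → Prop}
    (h : IsStrictPO lt) (hac : (hasseGraph lt).IsAcyclic) {r u x y : V}
    (hrx : lt r x) (hxu : lt x u) (hry : lt r y) (hyu : lt y u) :
    x = y ∨ lt x y ∨ lt y x := by
  have key : ∀ z, lt r z → lt z u → ∃ p : (hasseGraph lt).Walk r u, p.IsPath ∧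
      z ∈ p.support ∧ ∀ w ∈ p.support, w = z ∨ lt z w ∨ lt w z := by
    intro z hrz hzu
    obtain ⟨p, hp, hps⟩ := h.exists_path_hasseGraph hrz
    obtain ⟨q, hq, hqs⟩ := h.exists_path_hasseGraph hzu
    refine ⟨p.append q, hp.append_of_inter hq ?_, ?_, ?_⟩
    · intro w hwp hwq
      rcases (hps w hwp).2 with e | hwz
      · exact e
      · rcases (hqs w hwq).1 with e | hzw
        · exact e
        · exact absurd (h.2 _ _ _ hwz hzw) (h.1 w)
    · simp [SimpleGraph.Walk.mem_support_append_iff]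
    · intro w hw
      rw [SimpleGraph.Walk.mem_support_append_iff] at hw
      rcases hw with hw | hw
      · exact (hps w hw).2.imp_right Or.inr
      · exact (hqs w hw).1.imp_right Or.inl
  obtain ⟨p, hp, hxp, -⟩ := key x hrx hxu
  obtain ⟨q, hq, -, hqs⟩ := key y hry hyu
  have e : p = q := congrArg Subtype.val ((hac.subsingleton_path r _).elim ⟨p, hp⟩ ⟨q, hq⟩)
  have := hqs x (e ▸ hxp)
  tauto

/-- In a strict order with acyclic Hasse diagram, two incomparable elements with a common upper
bound have a least upper bound. -/
theorem IsStrictPO.exists_least_upper_bound {V : Type*} [Finite V] {lt : V → V → Prop}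
    (h : IsStrictPO lt) (hac : (hasseGraph lt).IsAcyclic) {r v u : V}
    (hne : r ≠ v) (hrv : ¬ lt r v) (hvr : ¬ lt v r) (hru : lt r u) (hvu : lt v u) :
    ∃ m, lt r m ∧ lt v m ∧ ∀ x, lt r x → lt v x → x = m ∨ lt m x := by
  have exists_min : ∀ x, lt r x → lt v x → ∃ m, lt r m ∧ lt v m ∧ (x = m ∨ lt m x) ∧
      ∀ y, lt r y → lt v y → ¬ lt y m := by
    intro x hrx hvx
    obtain ⟨m, ⟨h1, h2, h3⟩, hmin⟩ :=
      h.wellFounded.has_min {m | lt r m ∧ lt v m ∧ (x = m ∨ lt m x)} ⟨x, hrx, hvx, Or.inl rfl⟩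
    refine ⟨m, h1, h2, h3, fun y h4 h5 h6 => hmin y ⟨h4, h5, Or.inr ?_⟩ h6⟩
    rcases h3 with rfl | h3
    · exact h6
    · exact h.2 _ _ _ h6 h3
  have exists_path : ∀ m, lt r m → lt v m → (∀ y, lt r y → lt v y → ¬ lt y m) →
      ∃ p : (hasseGraph lt).Walk r v, p.IsPath ∧ m ∈ p.support ∧
        ∀ w ∈ p.support, w = m ∨ lt w m := by
    intro m hrm hvm hmin
    obtain ⟨p, hp, hps⟩ := h.exists_path_hasseGraph hrm
    obtain ⟨q, hq, hqs⟩ := h.exists_path_hasseGraph hvm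
    refine ⟨p.append q.reverse, hp.append_of_inter hq.reverse ?_, ?_, ?_⟩
    · intro w hwp hwq
      rw [SimpleGraph.Walk.support_reverse, List.mem_reverse] at hwq
      have := hps w hwp
      have := hqs w hwq
      have := hmin w
      grind
    · simp [SimpleGraph.Walk.mem_support_append_iff]
    · intro w hw
      rw [SimpleGraph.Walk.mem_support_append_iff, SimpleGraph.Walk.support_reverse,
        List.mem_reverse] at hw
      rcases hw with hw | hw
      · exact (hps w hw).2
      · exact (hqs w hw).2
  obtain ⟨m, hrm, hvm, -, hmin⟩ := exists_min u hru hvu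
  refine ⟨m, hrm, hvm, fun x hrx hvx => ?_⟩
  obtain ⟨n, hrn, hvn, hnx, hnmin⟩ := exists_min x hrx hvx
  obtain ⟨p, hp, hmp, -⟩ := exists_path m hrm hvm hmin
  obtain ⟨q, hq, -, hqs⟩ := exists_path n hrn hvn hnmin
  have e : p = q := congrArg Subtype.val ((hac.subsingleton_path r _).elim ⟨p, hp⟩ ⟨q, hq⟩)
  rcases hqs m (e ▸ hmp) with rfl | hmn
  · exact hnx
  · exact absurd hmn (hnmin m hrm hvm)

theorem IsTreelikeOrientation.p4Free_of_universal {V : Type*} [Finite V] {G : SimpleGraph V}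
    {lt : V → V → Prop} (h : IsTreelikeOrientation G lt) {r : V}
    (hr : ∀ v, v ≠ r → G.Adj r v) : P4Free G := by
  have hchain : ∀ r u x y, lt r x → lt x u → lt r y → lt y u → x = y ∨ lt x y ∨ lt y x :=
    fun _ _ _ _ => h.1.comparable_of_mem_interval h.2.2.isAcyclic
  obtain ⟨⟨-, htrans⟩, hadj, -⟩ := h
  rintro ⟨a, b, c, d, hab, hac, had, hbc, hbd, hcd, eab, ebc, ecd, nac, nad, nbd⟩
  have ha : a ≠ r := by rintro rfl; exact nac (hr c hac.symm)
  have hb : b ≠ r := by rintro rfl; exact nbd (hr d hbd.symm)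
  have hc : c ≠ r := by rintro rfl; exact nac (hr a hac).symm
  have hd : d ≠ r := by rintro rfl; exact nad (hr a had).symm
  have ra := (hadj r a).1 (hr a ha)
  have rb := (hadj r b).1 (hr b hb)
  have rc := (hadj r c).1 (hr c hc)
  have rd := (hadj r d).1 (hr d hd)
  rw [hadj] at eab ebc ecd nac nad nbd
  grind

theorem IsTreelikeOrientation.exists_closedNeighborhood_ssubset_of_lt {V : Type*} [Finite V]
    {G : SimpleGraph V} {lt : V → V → Prop} (h : IsTreelikeOrientation G lt) (hP : P4Free G)
    {r u v : V} (hne : r ≠ v) (hrv : ¬ G.Adj r v) (hru : lt r u) (hvu : lt v u) :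
    ∃ m, insert r (G.neighborSet r) ⊂ insert m (G.neighborSet m) := by
  have nrv := hrv
  rw [h.2.1] at nrv
  obtain ⟨m, hrm, hvm, hm⟩ := h.1.exists_least_upper_bound h.2.2.isAcyclic hne
    (fun e => nrv (Or.inl e)) (fun e => nrv (Or.inr e)) hru hvu
  have erm : G.Adj r m := (h.2.1 _ _).2 (Or.inl hrm)
  have emv : G.Adj m v := (h.2.1 _ _).2 (Or.inr hvm)
  refine ⟨m, Set.ssubset_iff_exists.2 ⟨?_, v, Or.inr emv, ?_⟩⟩
  · rintro x (rfl | hx)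
    · exact Or.inr erm.symm
    · by_contra hxm
      have hxm' : x ≠ m ∧ ¬ G.Adj m x := not_or.1 hxm
      have hrx : G.Adj r x := hx
      have hlt : lt r x := by
        rcases (h.2.1 _ _).1 hrx with e | e
        · exact e
        · exact absurd ((h.2.1 _ _).2 (Or.inr (h.1.2 _ _ _ e hrm))) hxm'.2
      have hxv : G.Adj x v := by
        by_contra hxv
        exact hP ⟨x, r, m, v, hrx.ne', hxm'.1, fun e => hrv (e ▸ hrx), erm.ne, hne, emv.ne,
          hrx.symm, erm, emv, fun e => hxm'.2 e.symm, hxv, hrv⟩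
      rcases (h.2.1 _ _).1 hxv with e | e
      · exact nrv (Or.inl (h.1.2 _ _ _ hlt e))
      · rcases hm x hlt e with e | e
        · exact hxm'.1 e
        · exact hxm'.2 ((h.2.1 _ _).2 (Or.inl e))
  · rintro (e | e)
    · exact hne e.symm
    · exact hrv e

theorem IsTreelikeOrientation.exists_universal {V : Type*} [Finite V] {G : SimpleGraph V}
    (hconn : G.Connected) {lt : V → V → Prop} (h : IsTreelikeOrientation G lt)
    (hP : P4Free G) : ∃ r : V, ∀ v : V, v ≠ r → G.Adj r v := by
  have := hconn.nonempty
  obtain ⟨r, -, hr⟩ := (InvImage.wf (fun r => insert r (G.neighborSet r))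
    (wellFounded_gt (α := Set V))).has_min Set.univ Set.univ_nonempty
  have hmax : ¬ ∃ m, insert r (G.neighborSet r) ⊂ insert m (G.neighborSet m) :=
    fun ⟨m, hm⟩ => hr m (Set.mem_univ m) hm
  have htwo : ∀ u v, G.Adj r u → G.Adj u v → v = r ∨ G.Adj r v := by
    intro u v hru huv
    by_contra! hv
    rcases (h.2.1 _ _).1 hru with ru | ur <;> rcases (h.2.1 _ _).1 huv with uv | vu
    · exact hv.2 ((h.2.1 _ _).2 (Or.inl (h.1.2 _ _ _ ru uv)))
    · exact hmax (h.exists_closedNeighborhood_ssubset_of_lt hP hv.1.symm hv.2 ru vu)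
    · exact hmax (h.flip.exists_closedNeighborhood_ssubset_of_lt hP hv.1.symm hv.2 ur uv)
    · exact hv.2 ((h.2.1 _ _).2 (Or.inr (h.1.2 _ _ _ vu ur)))
  refine ⟨r, fun v hv => ?_⟩
  have hreach : v = r ∨ G.Adj r v := by
    have hrv := (SimpleGraph.reachable_iff_reflTransGen r v).1 (hconn.preconnected r v)
    induction hrv with
    | refl => exact Or.inl rfl
    | @tail u w _ huw ih =>
      rcases eq_or_ne u r with rfl | hur
      · exact Or.inr huw
      · exact htwo u w ((ih hur).resolve_left hur) huw
  exact hreach.resolve_left hv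

/-- A connected graph is a double-arborescence iff it is a `P4`-free treelike
comparability graph. -/
theorem doubleArborescence_iff_P4Free_treelike
    {V : Type*} [Fintype V] (G : SimpleGraph V) (hconn : G.Connected) :
    IsDoubleArborescence G ↔ (P4Free G ∧ IsTreelikeComparability G) := by
  constructor
  · rintro ⟨⟨lt, h⟩, r, hr⟩
    exact ⟨h.p4Free_of_universal hr, lt, h⟩
  · rintro ⟨hP, lt, h⟩
    exact ⟨⟨lt, h⟩, h.exists_universal hconn hP⟩
end

section
/- Let G = (V, E) be a strict-double-arborescence, let r be a root of G (a vertex adjacent to all other vertices), and let ≺ be a treelike orientation of G. Then there exist vertices a1, a2 ∈ V with r ≺ a1 and r ≺ a2 such that a1 and a2 are incomparable under ≺ (hence non-adjacent in G), and there exist vertices a3, a4 ∈ V with a3 ≺ r and a4 ≺ r such that a3 and a4 are incomparable under ≺ (hence non-adjacent in G). -/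
/-- In a finite strict order in which every element is comparable to `r`, if the elements above `r`
are pairwise comparable, then there is a greatest element. -/
theorem exists_greatest_of_chain_above {V : Type*} [Finite V] {lt : V → V → Prop}
    (hirr : ∀ a, ¬ lt a a) (htrans : ∀ a b c, lt a b → lt b c → lt a c) {r : V}
    (hr : ∀ v, v ≠ r → lt r v ∨ lt v r)
    (hchain : ∀ a b, a ≠ b → lt r a → lt r b → lt a b ∨ lt b a) :
    ∃ m, ∀ v, v ≠ m → lt v m := by
  have : Std.Irrefl (fun a b => lt b a) := ⟨hirr⟩
  have : IsTrans V (fun a b => lt b a) := ⟨fun a b c hab hbc => htrans c b a hbc hab⟩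
  obtain ⟨m, -, hm⟩ := (Finite.wellFounded_of_trans_of_irrefl (fun a b => lt b a)).has_min
    Set.univ ⟨r, trivial⟩
  have hmax : ∀ v, ¬ lt m v := fun v => hm v trivial
  refine ⟨m, fun v hv => ?_⟩
  rcases eq_or_ne m r with rfl | hmr
  · exact (hr v hv).resolve_left (hmax v)
  have hrm : lt r m := (hr m hmr).resolve_right (hmax r)
  rcases eq_or_ne v r with rfl | hvr
  · exact hrm
  rcases hr v hvr with h | h
  · exact (hchain v m hv h hrm).resolve_right (hmax v)
  · exact htrans v r m h hrm

/-- In a strict-double-arborescence `G` with root `r` and treelike orientation `lt`,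
there are two incomparable (hence non-adjacent) vertices above `r` and two
incomparable (hence non-adjacent) vertices below `r`. -/
theorem strict_double_arborescence_two_incomparable
    {V : Type*} [Fintype V] (G : SimpleGraph V)
    (hda : IsDoubleArborescence G) (har : ¬ IsArborescence G)
    (r : V) (hr : ∀ v : V, v ≠ r → G.Adj r v)
    (lt : V → V → Prop) (hlt : IsTreelikeOrientation G lt) :
    (∃ a1 a2 : V, a1 ≠ a2 ∧ lt r a1 ∧ lt r a2 ∧
      ¬ lt a1 a2 ∧ ¬ lt a2 a1 ∧ ¬ G.Adj a1 a2) ∧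
    (∃ a3 a4 : V, a3 ≠ a4 ∧ lt a3 r ∧ lt a4 r ∧
      ¬ lt a3 a4 ∧ ¬ lt a4 a3 ∧ ¬ G.Adj a3 a4) := by
  obtain ⟨⟨hirr, htrans⟩, hadj, -⟩ := id hlt
  have hcomp : ∀ v, v ≠ r → lt r v ∨ lt v r := fun v hv => (hadj r v).1 (hr v hv)
  constructor
  · by_contra hno
    obtain ⟨m, hm⟩ := exists_greatest_of_chain_above hirr htrans hcomp fun a b hab ha hb => by
      by_contra hinc
      exact hno ⟨a, b, hab, ha, hb, fun h => hinc (.inl h), fun h => hinc (.inr h),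
        fun h => hinc ((hadj a b).1 h)⟩
    exact har ⟨lt, hlt, m, .inl hm⟩
  · by_contra hno
    obtain ⟨m, hm⟩ := exists_greatest_of_chain_above (lt := fun a b => lt b a) hirr
      (fun a b c hab hbc => htrans c b a hbc hab) (fun v hv => (hcomp v hv).symm)
      fun a b hab ha hb => by
        by_contra hinc
        exact hno ⟨a, b, hab, ha, hb, fun h => hinc (.inr h), fun h => hinc (.inl h),
          fun h => hinc ((hadj a b).1 h).symm⟩
    exact har ⟨lt, hlt, m, .inr hm⟩
end

section
/- Let G be a treelike comparability graph. Then G is C4-free if and only if no induced subgraph of G is a strict-double-arborescence (i.e., there is no vertex subset S such that the induced subgraph G[S] is a double-arborescence but not an arborescence). -/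
section CutsInHasseDiagrams

variable {α : Type*} [PartialOrder α]

/-- Deleting an edge `p ⋖ q` of an acyclic Hasse diagram splits the order into two sides such that
every comparable pair meeting both sides is separated by the pair `p`, `q`. -/
theorem CovBy.exists_cut_of_isAcyclic_hasse [Finite α] (hac : (SimpleGraph.hasse α).IsAcyclic)
    {p q : α} (hpq : p ⋖ q) :
    ∃ U : Set α, q ∈ U ∧ p ∉ U ∧ ∀ x y, x ≤ y → (x ∈ U ↔ y ∉ U) → x ≤ p ∧ q ≤ y := by
  classical
  have := Fintype.ofFinite α
  let := Fintype.toLocallyFiniteOrder (α := α)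
  let D := (SimpleGraph.hasse α).deleteEdges {s(p, q)}
  have hbridge : ¬ D.Reachable p q :=
    SimpleGraph.isBridge_iff.1 (SimpleGraph.isAcyclic_iff_forall_adj_isBridge.1 hac (Or.inl hpq))
  refine ⟨{x | D.Reachable q x}, SimpleGraph.Reachable.refl q, fun h ↦ hbridge h.symm, ?_⟩
  intro x y hxy
  induction le_iff_reflTransGen_covBy.1 hxy with
  | refl => tauto
  | @tail y z hxy' hyz ih =>
    have hle : x ≤ y := le_iff_reflTransGen_covBy.2 hxy'
    intro hsides
    by_cases hedge : s(y, z) = s(p, q)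
    · rcases Sym2.eq_iff.1 hedge with ⟨rfl, rfl⟩ | ⟨rfl, rfl⟩
      · exact ⟨hle, le_rfl⟩
      · exact absurd hyz.lt hpq.lt.asymm
    · have hadj : D.Adj y z := SimpleGraph.deleteEdges_adj.2 ⟨Or.inl hyz, hedge⟩
      have hiff : D.Reachable q y ↔ D.Reachable q z :=
        ⟨fun h ↦ h.trans hadj.reachable, fun h ↦ h.trans hadj.symm.reachable⟩
      have := ih hle (hsides.trans (not_congr hiff.symm))
      exact ⟨this.1, this.2.trans hyz.le⟩

/-- If `a` lies below `b` and `d`, where `¬ b ≤ d`, in an order with acyclic Hasse diagram,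
some common lower bound `p ≥ a` of `b` and `d` and some side `U` of an edge of the Hasse diagram
separate `b` from `d`, upper bounds of `b` and lower bounds of `d` being on the same side as these
elements. -/
theorem exists_cut_of_le_of_le [Finite α] (hac : (SimpleGraph.hasse α).IsAcyclic) {a b d : α}
    (hab : a ≤ b) (had : a ≤ d) (hbd : ¬ b ≤ d) :
    ∃ (p : α) (U : Set α), a ≤ p ∧ p ≤ b ∧ p ≤ d ∧ b ∈ U ∧ d ∉ U ∧
      (∀ x, b ≤ x → x ∈ U) ∧ (∀ x, x ≤ d → x ∉ U) ∧
      ∀ x y, x ≤ y → (x ∈ U ↔ y ∉ U) → x ≤ p := by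
  obtain ⟨p, hap, hp⟩ := (Set.toFinite {p : α | p ≤ b ∧ p ≤ d}).exists_le_maximal
    (show a ∈ {p : α | p ≤ b ∧ p ≤ d} from ⟨hab, had⟩)
  have hpb : p < b := lt_of_le_of_ne hp.prop.1 fun h ↦ hbd (h ▸ hp.prop.2)
  obtain ⟨q, hpq, hqb⟩ := exists_covBy_le_of_lt hpb
  have hqd : ¬ q ≤ d := fun h ↦ hpq.lt.not_ge (hp.le_of_ge ⟨hqb, h⟩ hpq.le)
  obtain ⟨U, hqU, hpU, hU⟩ := hpq.exists_cut_of_isAcyclic_hasse hac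
  have hup : ∀ x, b ≤ x → x ∈ U := fun x hx ↦ by
    by_contra hxU
    exact hpq.lt.not_ge (hU q x (hqb.trans hx) (by tauto)).1
  have hdU : d ∉ U := fun h ↦ hqd (hU p d hp.prop.2 (by tauto)).2
  refine ⟨p, U, hap, hpb.le, hp.prop.2, hup b le_rfl, hdU, hup, fun x hx hxU ↦ ?_,
    fun x y hxy h ↦ (hU x y hxy h).1⟩
  exact hqd (hU x d hx (by tauto)).2

/-- Two pairs `a`, `c` below `b`, `d`, with `¬ b ≤ d`, are separated by a single
element if the Hasse diagram is acyclic. -/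
theorem exists_between_of_isAcyclic_hasse [Finite α] (hac : (SimpleGraph.hasse α).IsAcyclic)
    {a b c d : α} (hab : a ≤ b) (had : a ≤ d) (hcb : c ≤ b) (hcd : c ≤ d) (hbd : ¬ b ≤ d) :
    ∃ m, a ≤ m ∧ c ≤ m ∧ m ≤ b ∧ m ≤ d := by
  obtain ⟨p, U, hap, hpb, hpd, hbU, -, -, hdown, hU⟩ := exists_cut_of_le_of_le hac hab had hbd
  have := hdown c hcd
  exact ⟨p, hap, hU c b hcb (by tauto), hpb, hpd⟩

/-- Intervals of an order with acyclic Hasse diagram are chains. -/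
theorem le_or_le_of_isAcyclic_hasse [Finite α] (hac : (SimpleGraph.hasse α).IsAcyclic)
    {a b d t : α} (hab : a ≤ b) (had : a ≤ d) (hbt : b ≤ t) (hdt : d ≤ t) : b ≤ d ∨ d ≤ b := by
  by_contra! h
  obtain ⟨p, U, -, hpb, -, -, hdU, hup, -, hU⟩ := exists_cut_of_le_of_le hac hab had h.1
  have := hup t hbt
  exact h.2 ((hU d t hdt (by tauto)).trans hpb)

end CutsInHasseDiagrams

section StrictOrders

variable {V : Type*} {lt : V → V → Prop}

/-- The partial order whose strict part is a given strict order. -/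
abbrev IsStrictPO.toPartialOrder (h : IsStrictPO lt) : PartialOrder V where
  le a b := a = b ∨ lt a b
  lt := lt
  le_refl _ := Or.inl rfl
  le_trans a b c := by
    rintro (rfl | hab) (rfl | hbc)
    exacts [Or.inl rfl, Or.inr hbc, Or.inr hab, Or.inr (h.2 _ _ _ hab hbc)]
  lt_iff_le_not_ge a b := by
    refine ⟨fun hab ↦ ⟨Or.inr hab, ?_⟩, ?_⟩
    · rintro (rfl | hba)
      exacts [h.1 _ hab, h.1 _ (h.2 _ _ _ hab hba)]
    · rintro ⟨rfl | hab, hba⟩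
      exacts [absurd (Or.inl rfl) hba, hab]
  le_antisymm a b := by
    rintro (rfl | hab) (hba | hba)
    exacts [rfl, rfl, hba.symm, absurd (h.2 _ _ _ hab hba) (h.1 _)]

theorem hasseGraph_lt_eq_hasse {α : Type*} [PartialOrder α] :
    hasseGraph (fun a b : α ↦ a < b) = SimpleGraph.hasse α := by
  ext a b
  change a ≠ b ∧ (a ⋖ b ∨ b ⋖ a) ↔ (a ⋖ b ∨ b ⋖ a)
  refine ⟨And.right, fun h ↦ ⟨?_, h⟩⟩
  rcases h with h | h
  exacts [h.ne, h.ne']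

theorem IsTreelikeOrientation.isAcyclic_hasse {G : SimpleGraph V}
    (h : IsTreelikeOrientation G lt) :
    letI := h.1.toPartialOrder
    (SimpleGraph.hasse V).IsAcyclic := by
  let := h.1.toPartialOrder
  rw [← hasseGraph_lt_eq_hasse]
  exact h.2.2.isAcyclic

theorem IsStrictPO.comap {W : Type*} (h : IsStrictPO lt) (f : W → V) :
    IsStrictPO fun a b ↦ lt (f a) (f b) :=
  ⟨fun _ ↦ h.1 _, fun _ _ _ ↦ h.2 _ _ _⟩

/-- If all elements are comparable to `m`, those below `m` are pairwise incomparable and those above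
`m` are pairwise incomparable, then the Hasse diagram is a star. -/
theorem hasseGraph_eq_starGraph (h : IsStrictPO lt) (m : V) (hm : ∀ v, v ≠ m → lt v m ∨ lt m v)
    (hdown : ∀ x y, lt x m → lt y m → ¬ lt x y) (hup : ∀ x y, lt m x → lt m y → ¬ lt x y) :
    hasseGraph lt = SimpleGraph.starGraph m := by
  have hcov : ∀ x y, CovRel lt x y → x = m ∨ y = m := by
    intro x y hxy
    by_contra! hne
    rcases hm x hne.1 with hx | hx <;> rcases hm y hne.2 with hy | hy
    · exact hdown x y hx hy hxy.1
    · exact hxy.2 m hx hy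
    · exact hup x y hx (h.2 _ _ _ hx hxy.1) hxy.1
    · exact hup x y hx hy hxy.1
  have hadj : ∀ v, v ≠ m → CovRel lt v m ∨ CovRel lt m v := by
    intro v hv
    rcases hm v hv with hvm | hvm
    · exact Or.inl ⟨hvm, fun c hvc hcm ↦ hdown v c hvm hcm hvc⟩
    · exact Or.inr ⟨hvm, fun c hmc hcv ↦ hup c v hmc hvm hcv⟩
  ext x y
  rw [SimpleGraph.starGraph_adj]
  change x ≠ y ∧ (CovRel lt x y ∨ CovRel lt y x) ↔ _
  refine and_congr_right fun hne ↦ ⟨?_, ?_⟩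
  · rintro (h | h)
    exacts [hcov x y h, (hcov y x h).symm]
  · rintro (rfl | rfl)
    exacts [(hadj y hne.symm).symm, hadj x hne]

end StrictOrders

section InducedFourCycles

variable {V : Type*} {G : SimpleGraph V} {lt : V → V → Prop}

/-- In a transitive orientation, an induced four-cycle consists of two sources and two sinks. -/
theorem HasInducedC4.exists_lt (hC : HasInducedC4 G) (hlt : IsStrictPO lt)
    (hG : ∀ a b, G.Adj a b ↔ (lt a b ∨ lt b a)) :
    ∃ a b c d, lt a b ∧ lt a d ∧ lt c b ∧ lt c d ∧ a ≠ c ∧ b ≠ d ∧ ¬ G.Adj a c ∧ ¬ G.Adj b d := by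
  obtain ⟨a, b, c, d, -, hac, -, -, hbd, -, ab, bc, cd, da, nac, nbd⟩ := hC
  have key : ∀ x y z, ¬ G.Adj x z → lt x y → ¬ lt y z := fun x y z hxz hxy hyz ↦
    hxz ((hG x z).2 (Or.inl (hlt.2 _ _ _ hxy hyz)))
  have nca : ¬ G.Adj c a := fun h ↦ nac h.symm
  have ndb : ¬ G.Adj d b := fun h ↦ nbd h.symm
  rw [hG] at ab bc cd da
  rcases ab with h | h
  · have h1 := bc.resolve_left (key a b c nac h)
    have h2 := cd.resolve_right fun h' ↦ key d c b ndb h' h1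
    exact ⟨a, b, c, d, h, da.resolve_left fun h' ↦ key c d a nca h2 h', h1, h2, hac, hbd, nac, nbd⟩
  · have h1 := bc.resolve_right fun h' ↦ key c b a nca h' h
    have h2 := cd.resolve_left (key b c d nbd h1)
    exact ⟨b, a, d, c, h, h1, da.resolve_right fun h' ↦ key b a d nbd h h', h2, hbd, hac, nbd, nac⟩

theorem IsArborescence.c4Free [Finite V] (h : IsArborescence G) : C4Free G := by
  obtain ⟨lt, hlt, r, hr⟩ := h
  intro hC
  obtain ⟨a, b, c, d, hab, had, hcb, hcd, hac, hbd, nac, nbd⟩ := hC.exists_lt hlt.1 hlt.2.1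
  have hasse := hlt.isAcyclic_hasse
  let := hlt.1.toPartialOrder
  have hinc : ∀ x y : V, x ≠ y → ¬ G.Adj x y → ¬ (x ≤ y ∨ y ≤ x) := by
    intro x y hne hn hle
    refine hn ((hlt.2.1 x y).2 (hle.imp (fun h ↦ h.resolve_left hne) fun h ↦ h.resolve_left hne.symm))
  rcases hr with hr | hr
  · have hle : ∀ v : V, v ≤ r := fun v ↦ (eq_or_ne v r).imp id (hr v)
    exact hinc b d hbd nbd
      (le_or_le_of_isAcyclic_hasse hasse (Or.inr hab) (Or.inr had) (hle b) (hle d))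
  · have hle : ∀ v : V, r ≤ v := fun v ↦ (eq_or_ne v r).imp Eq.symm (hr v)
    exact hinc a c hac nac
      (le_or_le_of_isAcyclic_hasse hasse (hle a) (hle c) (Or.inr hab) (Or.inr hcb))

theorem C4Free.induce (h : C4Free G) (S : Set V) : C4Free (G.induce S) := by
  rintro ⟨a, b, c, d, hab, hac, had, hbc, hbd, hcd, hadj⟩
  have hne {x y : S} (hxy : x ≠ y) : (x : V) ≠ y := Subtype.coe_injective.ne hxy
  exact h ⟨a, b, c, d, hne hab, hne hac, hne had, hne hbc, hne hbd, hne hcd, hadj⟩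

theorem IsDoubleArborescence.isArborescence_of_c4Free [Finite V] (h : IsDoubleArborescence G)
    (hC : C4Free G) : IsArborescence G := by
  obtain ⟨⟨lt, hlt⟩, r, hr⟩ := h
  refine ⟨lt, hlt, ?_⟩
  let := hlt.1.toPartialOrder
  have hadj : ∀ a b : V, G.Adj a b ↔ (a < b ∨ b < a) := hlt.2.1
  change ∃ r : V, (∀ v, v ≠ r → v < r) ∨ ∀ v, v ≠ r → r < v
  by_cases hdown : ∃ a c : V, a < r ∧ c < r ∧ a ≠ c ∧ ¬ G.Adj a c
  · obtain ⟨a, c, har, hcr, hac, nac⟩ := hdown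
    have hup : ∀ b d : V, r < b → r < d → b ≠ d → G.Adj b d := by
      intro b d hb hd hbd
      by_contra nbd
      have hab := har.trans hb
      have had := har.trans hd
      have hcb := hcr.trans hb
      have hcd := hcr.trans hd
      exact hC ⟨a, b, c, d, hab.ne, hac, had.ne, hcb.ne', hbd, hcd.ne, (hadj _ _).2 (.inl hab),
        (hadj _ _).2 (.inr hcb), (hadj _ _).2 (.inl hcd), (hadj _ _).2 (.inr had), nac, nbd⟩
    obtain ⟨t, hrt, ht⟩ := (Set.finite_univ (α := V)).exists_le_maximal (Set.mem_univ r)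
    have htop : ∀ x, ¬ t < x := fun x hx ↦ hx.not_ge (ht.le_of_ge (Set.mem_univ x) hx.le)
    refine ⟨t, Or.inl fun v hv ↦ ?_⟩
    rcases eq_or_ne v r with rfl | hvr
    · exact lt_of_le_of_ne hrt hv
    rcases (hadj r v).1 (hr v hvr) with hlt | hlt
    · rcases eq_or_lt_of_le hrt with rfl | hrt
      · exact absurd hlt (htop v)
      · exact ((hadj v t).1 (hup v t hlt hrt hv)).resolve_right (htop v)
    · exact hlt.trans_le hrt
  · push Not at hdown
    obtain ⟨t, htr, ht⟩ := (Set.finite_univ (α := V)).exists_le_minimal (Set.mem_univ r)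
    have hbot : ∀ x, ¬ x < t := fun x hx ↦ hx.not_ge (ht.le_of_le (Set.mem_univ x) hx.le)
    refine ⟨t, Or.inr fun v hv ↦ ?_⟩
    rcases eq_or_ne v r with rfl | hvr
    · exact lt_of_le_of_ne htr hv.symm
    rcases (hadj r v).1 (hr v hvr) with hlt | hlt
    · exact htr.trans_lt hlt
    · rcases eq_or_lt_of_le htr with rfl | htr
      · exact absurd hlt (hbot v)
      · exact ((hadj v t).1 (hdown v t hlt htr hv)).resolve_left (hbot v)

/-- An induced four-cycle of a treelike comparability graph extends by one vertex to an induced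
double-arborescence. -/
theorem IsTreelikeComparability.exists_isDoubleArborescence_of_hasInducedC4 [Finite V]
    (h : IsTreelikeComparability G) (hC : HasInducedC4 G) :
    ∃ S : Set V, IsDoubleArborescence (G.induce S) ∧ HasInducedC4 (G.induce S) := by
  obtain ⟨lt, hlt⟩ := h
  obtain ⟨a, b, c, d, hab, had, hcb, hcd, hac, hbd, nac, nbd⟩ := hC.exists_lt hlt.1 hlt.2.1
  have hasse := hlt.isAcyclic_hasse
  let := hlt.1.toPartialOrder
  have hadj : ∀ a b : V, G.Adj a b ↔ (a < b ∨ b < a) := hlt.2.1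
  change a < b at hab
  change a < d at had
  change c < b at hcb
  change c < d at hcd
  rw [hadj, not_or] at nac nbd
  obtain ⟨m, ham, hcm, hmb, hmd⟩ := exists_between_of_isAcyclic_hasse hasse hab.le had.le hcb.le
    hcd.le fun h ↦ nbd.1 (lt_of_le_of_ne h hbd)
  replace ham : a < m := lt_of_le_of_ne ham fun h ↦ nac.2 (lt_of_le_of_ne (h ▸ hcm) hac.symm)
  replace hcm : c < m := lt_of_le_of_ne hcm fun h ↦ nac.1 (h ▸ ham)
  replace hmb : m < b := lt_of_le_of_ne hmb fun h ↦ nbd.1 (lt_of_le_of_ne (h ▸ hmd) hbd)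
  replace hmd : m < d := lt_of_le_of_ne hmd fun h ↦ nbd.2 (h ▸ hmb)
  let S : Set V := {a, b, c, d, m}
  have hbelow : ∀ x ∈ S, x < m → x = a ∨ x = c := by
    rintro x (rfl | rfl | rfl | rfl | rfl) hx
    exacts [.inl rfl, absurd hx hmb.asymm, .inr rfl, absurd hx hmd.asymm, absurd hx (lt_irrefl _)]
  have habove : ∀ x ∈ S, m < x → x = b ∨ x = d := by
    rintro x (rfl | rfl | rfl | rfl | rfl) hx
    exacts [absurd hx ham.asymm, .inl rfl, absurd hx hcm.asymm, .inr rfl, absurd hx (lt_irrefl _)]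
  have hcomp : ∀ x ∈ S, x ≠ m → x < m ∨ m < x := by
    rintro x (rfl | rfl | rfl | rfl | rfl) hx
    exacts [.inl ham, .inr hmb, .inl hcm, .inr hmd, absurd rfl hx]
  have hmS : m ∈ S := by simp [S]
  refine ⟨S, ⟨⟨fun x y : S ↦ lt x y, hlt.1.comap _, fun x y ↦ hadj x y, ?_⟩,
    ⟨m, hmS⟩, fun v hv ↦ ?_⟩, ?_⟩
  · rw [hasseGraph_eq_starGraph (hlt.1.comap ((↑) : S → V)) ⟨m, hmS⟩
      (fun v hv ↦ hcomp v.1 v.2 fun h ↦ hv (Subtype.ext h)) ?_ ?_]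
    · exact SimpleGraph.isTree_starGraph _
    · rintro ⟨x, hxS⟩ ⟨y, hyS⟩ hx hy
      change ¬ x < y
      rcases hbelow x hxS hx with rfl | rfl <;> rcases hbelow y hyS hy with rfl | rfl
      exacts [lt_irrefl _, nac.1, nac.2, lt_irrefl _]
    · rintro ⟨x, hxS⟩ ⟨y, hyS⟩ hx hy
      change ¬ x < y
      rcases habove x hxS hx with rfl | rfl <;> rcases habove y hyS hy with rfl | rfl
      exacts [lt_irrefl _, nbd.1, nbd.2, lt_irrefl _]
  · exact (hadj m v).2 (hcomp v v.2 fun h ↦ hv (Subtype.ext h)).symm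
  · refine ⟨⟨a, by simp [S]⟩, ⟨b, by simp [S]⟩, ⟨c, by simp [S]⟩, ⟨d, by simp [S]⟩, ?_⟩
    simp only [ne_eq, Subtype.mk.injEq, SimpleGraph.comap_adj, Function.Embedding.subtype_apply,
      hadj]
    exact ⟨hab.ne, hac, had.ne, hcb.ne', hbd, hcd.ne, .inl hab, .inr hcb, .inl hcd, .inr had,
      not_or.2 nac, not_or.2 nbd⟩

end InducedFourCycles

/-- A treelike comparability graph is `C4`-free iff no induced subgraph of it is a
strict-double-arborescence. -/
theorem C4Free_iff_no_induced_strict_double_arborescence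
    {V : Type*} [Fintype V] (G : SimpleGraph V) (hconn : G.Connected)
    (htc : IsTreelikeComparability G) :
    C4Free G ↔ ∀ S : Set V,
      ¬ (IsDoubleArborescence (G.induce S) ∧ ¬ IsArborescence (G.induce S)) := by
  refine ⟨fun hC S hS ↦ hS.2 (hS.1.isArborescence_of_c4Free (hC.induce S)), fun h hC ↦ ?_⟩
  obtain ⟨S, hS, hCS⟩ := htc.exists_isDoubleArborescence_of_hasInducedC4 hC
  exact h S ⟨hS, fun harb ↦ harb.c4Free hCS⟩
end

section
/- If G is a double-arborescence on n vertices with clique number k, then ℓ(G) = 2n − k, i.e., the minimum length of a word representing G equals 2n − k. -/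
/-- Two distinct letters `a` and `b` alternate in the word `w`: the subsequence of `w`
consisting of all occurrences of `a` and `b` has no two consecutive equal letters. -/
def Alternates {V : Type*} [DecidableEq V] (w : List V) (a b : V) : Prop :=
  (w.filter (fun x => decide (x = a ∨ x = b))).Chain' (· ≠ ·)

/-- The word `w` represents the graph `G`: every vertex occurs in `w`, and distinct
vertices are adjacent iff they alternate in `w`. -/
def Represents {V : Type*} [DecidableEq V] (G : SimpleGraph V) (w : List V) : Prop :=
  (∀ v : V, v ∈ w) ∧ ∀ a b : V, a ≠ b → (G.Adj a b ↔ Alternates w a b)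

/-- The word `w`, whose letters all lie in `S`, represents the induced subgraph `G[S]`. -/
def RepresentsOn {V : Type*} [DecidableEq V] (G : SimpleGraph V) (S : Set V)
    (w : List V) : Prop :=
  (∀ x ∈ w, x ∈ S) ∧ (∀ v ∈ S, v ∈ w) ∧
    ∀ a ∈ S, ∀ b ∈ S, a ≠ b → (G.Adj a b ↔ Alternates w a b)

theorem pairwise_support_append {V : Type*} {lt : V → V → Prop} (hlt : IsStrictPO lt)
    {H : SimpleGraph V} {a b c : V} {p : H.Walk a b} {q : H.Walk b c}
    (hp : p.support.Pairwise lt) (hq : q.support.Pairwise lt) :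
    (p.append q).support.Pairwise lt := by
  rw [SimpleGraph.Walk.support_append]
  have hq' := hq
  rw [← SimpleGraph.Walk.cons_tail_support, List.pairwise_cons] at hq'
  rw [List.pairwise_append]
  refine ⟨hp, hq'.2, fun x hx y hy => ?_⟩
  have hby := hq'.1 y hy
  rw [SimpleGraph.Walk.mem_support_iff_exists_append] at hx
  obtain ⟨s, t, rfl⟩ := hx
  by_cases hxb : x = b
  · rwa [hxb]
  · rw [SimpleGraph.Walk.support_append_eq_support_dropLast_append,
      List.pairwise_append] at hp
    have ht := hp.2.1
    rw [← SimpleGraph.Walk.cons_tail_support, List.pairwise_cons] at ht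
    refine hlt.2 _ _ _ (ht.1 b ?_) hby
    have : b ∈ t.support := t.end_mem_support
    rw [← SimpleGraph.Walk.cons_tail_support, List.mem_cons] at this
    exact this.resolve_left (Ne.symm hxb)

theorem isPath_of_pairwise_support {V : Type*} {lt : V → V → Prop} (hlt : IsStrictPO lt)
    {H : SimpleGraph V} {a b : V} {p : H.Walk a b} (hp : p.support.Pairwise lt) : p.IsPath := by
  rw [SimpleGraph.Walk.isPath_def]
  refine List.Pairwise.imp (fun {x y} h => ?_) hp
  rintro rfl
  exact hlt.1 _ h

/-- The Hasse diagram of a finite strict order joins comparable elements by increasing walks. -/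
theorem exists_increasing_hasse_walk {V : Type*} [Fintype V] {lt : V → V → Prop}
    (hlt : IsStrictPO lt) {a b : V} (hab : lt a b) :
    ∃ p : (hasseGraph lt).Walk a b, p.support.Pairwise lt := by
  classical
  induction hm : (Finset.univ.filter fun c => lt a c ∧ lt c b).card using Nat.strong_induction_on
    generalizing a b with
  | _ m ih =>
    by_cases hcov : CovRel lt a b
    · have hadj : (hasseGraph lt).Adj a b := by
        refine (SimpleGraph.fromRel_adj _ _ _).2 ⟨?_, Or.inl hcov⟩
        rintro rfl
        exact hlt.1 _ hab
      exact ⟨hadj.toWalk, by simp [SimpleGraph.Adj.toWalk, hab]⟩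
    · obtain ⟨c, hac, hcb⟩ : ∃ c, lt a c ∧ lt c b := by
        by_contra! h
        exact hcov ⟨hab, h⟩
      obtain ⟨p, hp⟩ := ih _ (by
        rw [← hm]
        refine Finset.card_lt_card ((Finset.ssubset_iff_of_subset ?_).2 ⟨c, ?_, ?_⟩)
        · intro d hd
          simp only [Finset.mem_filter, Finset.mem_univ, true_and] at hd ⊢
          exact ⟨hd.1, hlt.2 _ _ _ hd.2 hcb⟩
        · simp [hac, hcb]
        · simp [hlt.1]) hac rfl
      obtain ⟨q, hq⟩ := ih _ (by
        rw [← hm]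
        refine Finset.card_lt_card ((Finset.ssubset_iff_of_subset ?_).2 ⟨c, ?_, ?_⟩)
        · intro d hd
          simp only [Finset.mem_filter, Finset.mem_univ, true_and] at hd ⊢
          exact ⟨hlt.2 _ _ _ hac hd.1, hd.2⟩
        · simp [hac, hcb]
        · simp [hlt.1]) hcb rfl
      exact ⟨p.append q, pairwise_support_append hlt hp hq⟩

/-- In a finite strict order whose Hasse diagram is a tree, every interval is a chain. -/
theorem comparable_of_mem_interval {V : Type*} [Fintype V] {lt : V → V → Prop}
    (hlt : IsStrictPO lt) (htree : (hasseGraph lt).IsTree) {r a b x : V}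
    (hra : lt r a) (hax : lt a x) (hrb : lt r b) (hbx : lt b x) (hab : a ≠ b) :
    lt a b ∨ lt b a := by
  obtain ⟨p₁, hp₁⟩ := exists_increasing_hasse_walk hlt hra
  obtain ⟨p₂, hp₂⟩ := exists_increasing_hasse_walk hlt hax
  obtain ⟨q₁, hq₁⟩ := exists_increasing_hasse_walk hlt hrb
  obtain ⟨q₂, hq₂⟩ := exists_increasing_hasse_walk hlt hbx
  have hp := pairwise_support_append hlt hp₁ hp₂
  have hq := pairwise_support_append hlt hq₁ hq₂
  have hpq := (htree.existsUnique_path r x).unique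
    (isPath_of_pairwise_support hlt hp) (isPath_of_pairwise_support hlt hq)
  have ha : a ∈ (p₁.append p₂).support := by simp
  have hb : b ∈ (p₁.append p₂).support := by rw [hpq]; simp
  have : Std.Symm fun u v => lt u v ∨ lt v u := ⟨fun _ _ h => h.symm⟩
  exact (hp.imp (S := fun u v => lt u v ∨ lt v u) Or.inl).forall ha hb hab

section

open scoped List

theorem pair_sublist_append {V : Type*} {A B : List V} {x y : V} (hx : x ∈ A) (hy : y ∈ B) :
    [x, y] <+ A ++ B :=
  List.Sublist.append (List.singleton_sublist.2 hx) (List.singleton_sublist.2 hy)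

theorem exists_minimal_mem {V : Type*} {lt : V → V → Prop} (hlt : IsStrictPO lt)
    {S : Finset V} (hS : S.Nonempty) : ∃ c ∈ S, ∀ x ∈ S, ¬ lt x c := by
  have : IsStrictOrder V lt := { irrefl := hlt.1, trans := hlt.2 }
  obtain ⟨x, hx⟩ := hS
  obtain ⟨c, -, h⟩ := (Finset.wellFoundedOn S (r := lt)).has_min Set.univ ⟨⟨x, hx⟩, trivial⟩
  exact ⟨c, c.2, fun y hy => h ⟨y, hy⟩ trivial⟩

/-- A finite forest order has two linear extensions, as lists, that disagree on all incomparable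
pairs; for a downward closed chain `K`, the second may list the elements of `K` after all elements
incomparable to them. -/
theorem exists_forest_realizer {V : Type*} {lt : V → V → Prop}
    (hlt : IsStrictPO lt) (K : Set V) (hK : ∀ a ∈ K, ∀ b ∈ K, a ≠ b → lt a b ∨ lt b a)
    (S : Finset V) (hdown : ∀ x ∈ S, ∀ c ∈ S, c ∈ K → lt x c → x ∈ K)
    (hforest : ∀ x ∈ S, ∀ a ∈ S, ∀ b ∈ S, lt a x → lt b x → a ≠ b → lt a b ∨ lt b a) :
    ∃ L M : List V, L.Nodup ∧ M.Nodup ∧ (∀ x, x ∈ L ↔ x ∈ S) ∧ (∀ x, x ∈ M ↔ x ∈ S) ∧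
      (∀ x ∈ S, ∀ y ∈ S, lt x y → [x, y] <+ L ∧ [x, y] <+ M) ∧
      (∀ x ∈ S, ∀ y ∈ S, x ≠ y → ¬ lt x y → ¬ lt y x →
        ([x, y] <+ L ∧ [y, x] <+ M) ∨ ([y, x] <+ L ∧ [x, y] <+ M)) ∧
      (∀ x ∈ S, ∀ y ∈ S, x ∉ K → y ∈ K → ¬ lt x y → ¬ lt y x → [x, y] <+ M) := by
  classical
  induction S using Finset.strongInduction with
  | _ S ih =>
    rcases S.eq_empty_or_nonempty with rfl | hne
    · exact ⟨[], [], by simp⟩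
    obtain ⟨c, hcS, hmin, hcK⟩ : ∃ c ∈ S, (∀ x ∈ S, ¬ lt x c) ∧ ((∃ y ∈ S, y ∈ K) → c ∈ K) := by
      by_cases hKS : ∃ y ∈ S, y ∈ K
      · obtain ⟨c, hc, hmin⟩ := exists_minimal_mem hlt (S := S.filter (· ∈ K))
          (by obtain ⟨y, hy, hyK⟩ := hKS; exact ⟨y, by simp [hy, hyK]⟩)
        rw [Finset.mem_filter] at hc
        exact ⟨c, hc.1, fun x hx hxc => hmin x
          (Finset.mem_filter.2 ⟨hx, hdown x hx c hc.1 hc.2 hxc⟩) hxc, fun _ => hc.2⟩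
      · obtain ⟨c, hc, hmin⟩ := exists_minimal_mem hlt hne
        exact ⟨c, hc, hmin, fun h => absurd h hKS⟩
    have hTS : ∀ x ∈ S.filter (lt c), x ∈ S := fun x hx => (Finset.mem_filter.1 hx).1
    have hRS : ∀ x ∈ S.filter (fun x => x ≠ c ∧ ¬ lt c x), x ∈ S :=
      fun x hx => (Finset.mem_filter.1 hx).1
    obtain ⟨L₁, M₁, hL₁, hM₁, mL₁, mM₁, h₁, i₁, k₁⟩ := ih (S.filter (lt c))
      ((Finset.ssubset_iff_of_subset hTS).2 ⟨c, hcS, by simp [hlt.1]⟩)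
      (fun x hx y hy => hdown x (hTS x hx) y (hTS y hy))
      (fun x hx a ha b hb => hforest x (hTS x hx) a (hTS a ha) b (hTS b hb))
    obtain ⟨L₂, M₂, hL₂, hM₂, mL₂, mM₂, h₂, i₂, k₂⟩ := ih (S.filter (fun x => x ≠ c ∧ ¬ lt c x))
      ((Finset.ssubset_iff_of_subset hRS).2 ⟨c, hcS, by simp⟩)
      (fun x hx y hy => hdown x (hRS x hx) y (hRS y hy))
      (fun x hx a ha b hb => hforest x (hRS x hx) a (hRS a ha) b (hRS b hb))
    simp only [Finset.mem_filter] at mL₁ mM₁ h₁ i₁ k₁ mL₂ mM₂ h₂ i₂ k₂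
    have hcc := hlt.1 c
    have hRK : ∀ x ∈ S, x ≠ c → ¬ lt c x → x ∉ K := by
      intro x hx hxc hcx hxK
      rcases hK x hxK c (hcK ⟨x, hx, hxK⟩) hxc with h | h
      · exact hmin x hx h
      · exact hcx h
    have hTR : ∀ t ∈ S, ∀ x ∈ S, (t = c ∨ lt c t) → x ≠ c → ¬ lt c x → ¬ lt t x ∧ ¬ lt x t := by
      intro t ht x hx hct hxc hcx
      constructor
      · intro h
        rcases hct with rfl | hct
        · exact hcx h
        · exact hcx (hlt.2 _ _ _ hct h)
      · intro h
        rcases hct with rfl | hct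
        · exact hmin x hx h
        · rcases hforest t ht x hx c hcS h hct hxc with h' | h'
          · exact hmin x hx h'
          · exact hcx h'
    have split : ∀ x ∈ S, (x = c ∨ lt c x) ∨ (x ≠ c ∧ ¬ lt c x) := fun x _ => by tauto
    have mcL : ∀ x ∈ S, (x = c ∨ lt c x) → x ∈ c :: L₁ := fun x hx h =>
      List.mem_cons.2 (h.imp_right fun h => (mL₁ x).2 ⟨hx, h⟩)
    have mcM : ∀ x ∈ S, (x = c ∨ lt c x) → x ∈ c :: M₁ := fun x hx h =>
      List.mem_cons.2 (h.imp_right fun h => (mM₁ x).2 ⟨hx, h⟩)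
    have cross : ∀ x ∈ S, ∀ y ∈ S, (x = c ∨ lt c x) → (y ≠ c ∧ ¬ lt c y) →
        [x, y] <+ (c :: L₁) ++ L₂ ∧ [y, x] <+ M₂ ++ (c :: M₁) := fun x hx y hy hcx hcy =>
      ⟨pair_sublist_append (mcL x hx hcx) ((mL₂ y).2 ⟨hy, hcy⟩),
        pair_sublist_append ((mM₂ y).2 ⟨hy, hcy⟩) (mcM x hx hcx)⟩
    have left : ∀ {x y : V} {A B : List V}, [x, y] <+ A → [x, y] <+ A ++ B :=
      fun h => h.trans (List.sublist_append_left _ _)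
    have right : ∀ {x y : V} {A B : List V}, [x, y] <+ B → [x, y] <+ A ++ B :=
      fun h => h.trans (List.sublist_append_right _ _)
    refine ⟨(c :: L₁) ++ L₂, M₂ ++ (c :: M₁), ?_, ?_, ?_, ?_, ?_, ?_, ?_⟩
    · simp only [List.nodup_append, List.nodup_cons, List.mem_cons]
      grind
    · simp only [List.nodup_append, List.nodup_cons, List.mem_cons]
      grind
    · intro x
      simp only [List.mem_append, List.mem_cons]
      grind
    · intro x
      simp only [List.mem_append, List.mem_cons]
      grind
    · intro x hx y hy hxy
      rcases split x hx with hcx | hcx <;> rcases split y hy with hcy | hcy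
      · rcases hcx with rfl | hcx
        · have hcy := hcy.resolve_left (by rintro rfl; exact hcc hxy)
          exact ⟨left (by simpa using (mL₁ y).2 ⟨hy, hcy⟩),
            right (by simpa using (mM₁ y).2 ⟨hy, hcy⟩)⟩
        · have hcy := hlt.2 _ _ _ hcx hxy
          have := h₁ x ⟨hx, hcx⟩ y ⟨hy, hcy⟩ hxy
          exact ⟨left (this.1.cons _), right (this.2.cons _)⟩
      · exact absurd hxy (hTR x hx y hy hcx hcy.1 hcy.2).1
      · exact absurd hxy (hTR y hy x hx hcy hcx.1 hcx.2).2
      · have := h₂ x ⟨hx, hcx⟩ y ⟨hy, hcy⟩ hxy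
        exact ⟨right this.1, left this.2⟩
    · intro x hx y hy hne hxy hyx
      rcases split x hx with hcx | hcx <;> rcases split y hy with hcy | hcy
      · have hcx := hcx.resolve_left (by rintro rfl; exact hcy.elim (fun h => hne h.symm) hxy)
        have hcy := hcy.resolve_left (by rintro rfl; exact hyx hcx)
        exact (i₁ x ⟨hx, hcx⟩ y ⟨hy, hcy⟩ hne hxy hyx).imp
          (fun h => ⟨left (h.1.cons _), right (h.2.cons _)⟩)
          (fun h => ⟨left (h.1.cons _), right (h.2.cons _)⟩)
      · exact Or.inl (cross x hx y hy hcx hcy)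
      · exact Or.inr (cross y hy x hx hcy hcx)
      · exact (i₂ x ⟨hx, hcx⟩ y ⟨hy, hcy⟩ hne hxy hyx).imp
          (fun h => ⟨right h.1, left h.2⟩) (fun h => ⟨right h.1, left h.2⟩)
    · intro x hx y hy hxK hyK hxy hyx
      have hcy := (split y hy).resolve_right fun h => hRK y hy h.1 h.2 hyK
      rcases split x hx with hcx | hcx
      · have hcx := hcx.resolve_left (by rintro rfl; exact hxK (hcK ⟨y, hy, hyK⟩))
        have hcy := hcy.resolve_left (by rintro rfl; exact hyx hcx)
        exact right ((k₁ x ⟨hx, hcx⟩ y ⟨hy, hcy⟩ hxK hyK hxy hyx).cons _)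
      · exact (cross y hy x hx hcy hcx).2

/-- One side of a universal vertex `r` in an order with chains as intervals: vertices above `r`
have a pair of lists agreeing on adjacent pairs only, where the second list places the elements of
a maximal clique `K` before their neighbours and after their non-neighbours outside `K`. -/
theorem exists_realizer_above {V : Type*} [Fintype V] {G : SimpleGraph V} {lt : V → V → Prop}
    (hlt : IsStrictPO lt) (hadj : ∀ a b, G.Adj a b ↔ (lt a b ∨ lt b a))
    (hint : ∀ r a b x, lt r a → lt a x → lt r b → lt b x → a ≠ b → lt a b ∨ lt b a)
    {r : V} (hr : ∀ v, v ≠ r → G.Adj r v) {K : Finset V} (hK : G.IsClique K)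
    (hmax : ∀ x, (∀ y ∈ K, x ≠ y → G.Adj x y) → x ∈ K) :
    ∃ L M : List V, L.Nodup ∧ M.Nodup ∧ (∀ x, x ∈ L ↔ lt r x) ∧ (∀ x, x ∈ M ↔ lt r x) ∧
      (∀ x y, lt r x → lt r y → G.Adj x y →
        ([x, y] <+ L ∧ [x, y] <+ M) ∨ ([y, x] <+ L ∧ [y, x] <+ M)) ∧
      (∀ x y, lt r x → lt r y → x ≠ y → ¬ G.Adj x y →
        ([x, y] <+ L ∧ [y, x] <+ M) ∨ ([y, x] <+ L ∧ [x, y] <+ M)) ∧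
      (∀ x y, lt r x → lt r y → x ∉ K → y ∈ K → G.Adj x y → [y, x] <+ M) ∧
      (∀ x y, lt r x → lt r y → x ∉ K → y ∈ K → ¬ G.Adj x y → [x, y] <+ M) := by
  classical
  have hdown : ∀ x, lt r x → ∀ c, c ∈ K → lt x c → x ∈ K := by
    intro x hx c hc hxc
    refine hmax x fun y hy hxy => (hadj _ _).2 ?_
    by_cases hyc : y = c
    · exact Or.inl (hyc ▸ hxc)
    rcases (hadj _ _).1 (hK hy hc hyc) with h | h
    · by_cases hyr : y = r
      · exact Or.inr (hyr ▸ hx)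
      rcases (hadj _ _).1 (hr y hyr) with h' | h'
      · exact hint r x y c hx hxc h' h hxy
      · exact Or.inr (hlt.2 _ _ _ h' hx)
    · exact Or.inl (hlt.2 _ _ _ hxc h)
  obtain ⟨L, M, hL, hM, mL, mM, h, i, k⟩ := exists_forest_realizer hlt (K : Set V)
    (fun a ha b hb hab => (hadj a b).1 (hK ha hb hab)) (Finset.univ.filter (lt r))
    (fun x hx c _ hc hxc => hdown x (by simpa using hx) c hc hxc)
    (fun x _ a ha b hb hax hbx hab =>
      hint r a b x (by simpa using ha) hax (by simpa using hb) hbx hab)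
  simp only [Finset.mem_filter, Finset.mem_univ, true_and, Finset.mem_coe] at mL mM h i k
  refine ⟨L, M, hL, hM, mL, mM, ?_, ?_, ?_, ?_⟩
  · intro x y hx hy hxy
    exact ((hadj _ _).1 hxy).imp (h x hx y hy) (h y hy x hx)
  · intro x y hx hy hne hxy
    rw [hadj, not_or] at hxy
    exact i x hx y hy hne hxy.1 hxy.2
  · intro x y hx hy hxK hyK hxy
    rcases (hadj _ _).1 hxy with h' | h'
    · exact absurd (hdown x hx y hyK h') hxK
    · exact (h y hy x hx h').2
  · intro x y hx hy hxK hyK hxy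
    rw [hadj, not_or] at hxy
    exact k x hx y hy hxK hyK hxy.1 hxy.2

theorem filter_eq_pair {V : Type*} [DecidableEq V] {L : List V} (hL : L.Nodup) {a b : V}
    (h : [a, b] <+ L) : L.filter (fun x => decide (x = a ∨ x = b)) = [a, b] := by
  have hsub := h.filter (fun x => decide (x = a ∨ x = b))
  rw [List.filter_eq_self.2 (by simp)] at hsub
  refine (hsub.eq_of_length_le ?_).symm
  have : (L.filter (fun x => decide (x = a ∨ x = b))) ⊆ [a, b] := by
    intro x hx
    simpa using (List.mem_filter.1 hx).2
  exact ((hL.filter _).subperm this).length_le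

theorem filter_eq_singleton {V : Type*} [DecidableEq V] {L : List V} (hL : L.Nodup) {a b : V}
    (ha : a ∈ L) (hb : b ∉ L) : L.filter (fun x => decide (x = a ∨ x = b)) = [a] := by
  have hsub := (List.singleton_sublist.2 ha).filter (fun x => decide (x = a ∨ x = b))
  rw [List.filter_eq_self.2 (by simp)] at hsub
  refine (hsub.eq_of_length_le ?_).symm
  have : (L.filter (fun x => decide (x = a ∨ x = b))) ⊆ [a] := by
    intro x hx
    rw [List.mem_filter, decide_eq_true_eq] at hx
    rcases hx.2 with rfl | rfl
    · simp
    · exact absurd hx.1 hb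
  exact ((hL.filter _).subperm this).length_le

theorem alternates_comm {V : Type*} [DecidableEq V] {w : List V} {a b : V} :
    Alternates w a b ↔ Alternates w b a := by
  simp only [Alternates, or_comm]

theorem alternates_of_nodup_filter {V : Type*} [DecidableEq V] {w : List V} {a b : V}
    (h : (w.filter (fun x => decide (x = a ∨ x = b))).Nodup) : Alternates w a b :=
  List.Pairwise.isChain h

/-- Two enumerations `X`, `Y` of the vertices that agree exactly on adjacent pairs outside a
clique `K` yield a word for `G` in which each element of `K` occurs once, elements satisfying `P`
being kept in the second half and the others in the first half. -/
theorem represents_of_realizer {V : Type*} [Fintype V] [DecidableEq V] {G : SimpleGraph V}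
    {K : Finset V} (hK : G.IsClique K) (P : V → Prop) [DecidablePred P] {X Y : List V}
    (hX : X.Nodup) (hY : Y.Nodup) (mX : ∀ v, v ∈ X) (mY : ∀ v, v ∈ Y)
    (adj : ∀ a b, a ∉ K → b ∉ K → G.Adj a b →
      ([a, b] <+ X ∧ [a, b] <+ Y) ∨ ([b, a] <+ X ∧ [b, a] <+ Y))
    (nadj : ∀ a b, a ∉ K → b ∉ K → a ≠ b → ¬ G.Adj a b →
      ([a, b] <+ X ∧ [b, a] <+ Y) ∨ ([b, a] <+ X ∧ [a, b] <+ Y))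
    (adjX : ∀ x c, x ∉ K → c ∈ K → ¬ P c → G.Adj x c → [x, c] <+ X)
    (nadjX : ∀ x c, x ∉ K → c ∈ K → ¬ P c → ¬ G.Adj x c → [c, x] <+ X)
    (adjY : ∀ x c, x ∉ K → c ∈ K → P c → G.Adj x c → [c, x] <+ Y)
    (nadjY : ∀ x c, x ∉ K → c ∈ K → P c → ¬ G.Adj x c → [x, c] <+ Y) :
    ∃ w : List V, Represents G w ∧ w.length = 2 * Fintype.card V - K.card := by
  set A := X.filter (fun x => decide (x ∉ K ∨ ¬ P x)) with hA
  set B := Y.filter (fun x => decide (x ∉ K ∨ P x)) with hB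
  have nA : A.Nodup := hX.filter _
  have nB : B.Nodup := hY.filter _
  have mA : ∀ v, v ∈ A ↔ (v ∉ K ∨ ¬ P v) := fun v => by simp [hA, mX v]
  have mB : ∀ v, v ∈ B ↔ (v ∉ K ∨ P v) := fun v => by simp [hB, mY v]
  have sA : ∀ {a b}, a ∈ A → b ∈ A → [a, b] <+ X → [a, b] <+ A := by
    intro a b ha hb h
    have := h.filter (fun x => decide (x ∉ K ∨ ¬ P x))
    rwa [List.filter_eq_self.2 (by simp [← mA, ha, hb])] at this
  have sB : ∀ {a b}, a ∈ B → b ∈ B → [a, b] <+ Y → [a, b] <+ B := by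
    intro a b ha hb h
    have := h.filter (fun x => decide (x ∉ K ∨ P x))
    rwa [List.filter_eq_self.2 (by simp [← mB, ha, hb])] at this
  have same : ∀ {a b}, a ≠ b → [a, b] <+ A → [a, b] <+ B → Alternates (A ++ B) a b := by
    intro a b hab h h'
    change List.IsChain _ _
    rw [List.filter_append, filter_eq_pair nA h, filter_eq_pair nB h']
    simp [hab, hab.symm]
  have opposite : ∀ {a b}, [a, b] <+ A → [b, a] <+ B → ¬ Alternates (A ++ B) a b := by
    intro a b h h'
    change ¬ List.IsChain _ _
    have e := filter_eq_pair nB h'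
    simp only [or_comm] at e
    rw [List.filter_append, filter_eq_pair nA h, e]
    simp
  have outer : ∀ x c, x ∉ K → c ∈ K → (G.Adj x c ↔ Alternates (A ++ B) x c) := by
    intro x c hx hc
    have hxc : x ≠ c := by rintro rfl; exact hx hc
    have hxA := (mA x).2 (Or.inl hx)
    have hxB := (mB x).2 (Or.inl hx)
    by_cases hP : P c
    · have hcA : c ∉ A := by simp [mA, hc, hP]
      have hcB := (mB c).2 (Or.inr hP)
      have e := filter_eq_singleton nA hxA hcA
      constructor
      · intro h
        have e' := filter_eq_pair nB (sB hcB hxB (adjY x c hx hc hP h))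
        simp only [or_comm] at e'
        change List.IsChain _ _
        rw [List.filter_append, e, e']
        simp [hxc, hxc.symm]
      · contrapose
        intro h
        have e' := filter_eq_pair nB (sB hxB hcB (nadjY x c hx hc hP h))
        change ¬ List.IsChain _ _
        rw [List.filter_append, e, e']
        simp
    · have hcB : c ∉ B := by simp [mB, hc, hP]
      have hcA := (mA c).2 (Or.inr hP)
      have e := filter_eq_singleton nB hxB hcB
      constructor
      · intro h
        have e' := filter_eq_pair nA (sA hxA hcA (adjX x c hx hc hP h))
        change List.IsChain _ _
        rw [List.filter_append, e, e']
        simp [hxc, hxc.symm]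
      · contrapose
        intro h
        have e' := filter_eq_pair nA (sA hcA hxA (nadjX x c hx hc hP h))
        simp only [or_comm] at e'
        change ¬ List.IsChain _ _
        rw [List.filter_append, e, e']
        simp
  refine ⟨A ++ B, ⟨fun v => ?_, fun a b hab => ?_⟩, ?_⟩
  · rw [List.mem_append, mA, mB]
    tauto
  · by_cases ha : a ∈ K <;> by_cases hb : b ∈ K
    · refine iff_of_true (hK ha hb hab) (alternates_of_nodup_filter ?_)
      rw [List.filter_append, List.nodup_append]
      refine ⟨nA.filter _, nB.filter _, ?_⟩
      rintro x hx _ hy rfl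
      rw [List.mem_filter, decide_eq_true_eq] at hx hy
      have hxK : x ∈ K := by rcases hx.2 with rfl | rfl <;> assumption
      have h₁ := (mA x).1 hx.1
      have h₂ := (mB x).1 hy.1
      tauto
    · rw [G.adj_comm, alternates_comm]
      exact outer b a hb ha
    · exact outer a b ha hb
    · have haA := (mA a).2 (Or.inl ha)
      have haB := (mB a).2 (Or.inl ha)
      have hbA := (mA b).2 (Or.inl hb)
      have hbB := (mB b).2 (Or.inl hb)
      constructor
      · intro h
        rcases adj a b ha hb h with h | h
        · exact same hab (sA haA hbA h.1) (sB haB hbB h.2)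
        · exact alternates_comm.1 (same hab.symm (sA hbA haA h.1) (sB hbB haB h.2))
      · contrapose
        intro h
        rcases nadj a b ha hb hab h with h | h
        · exact opposite (sA haA hbA h.1) (sB hbB haB h.2)
        · exact fun h' => opposite (sA hbA haA h.1) (sB haB hbB h.2) (alternates_comm.1 h')
  · have lA : A.length = (Finset.univ.filter fun x => x ∉ K ∨ ¬ P x).card := by
      rw [← List.toFinset_card_of_nodup nA]
      congr 1
      ext v
      simp [mA]
    have lB : B.length = (Finset.univ.filter fun x => x ∉ K ∨ P x).card := by
      rw [← List.toFinset_card_of_nodup nB]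
      congr 1
      ext v
      simp [mB]
    have hsum := Finset.card_union_add_card_inter (Finset.univ.filter fun x => x ∉ K ∨ ¬ P x)
      (Finset.univ.filter fun x => x ∉ K ∨ P x)
    have hunion : (Finset.univ.filter fun x => x ∉ K ∨ ¬ P x) ∪
        (Finset.univ.filter fun x => x ∉ K ∨ P x) = Finset.univ := by
      ext v
      simp only [Finset.mem_union, Finset.mem_filter, Finset.mem_univ, true_and, iff_true]
      tauto
    have hinter : (Finset.univ.filter fun x => x ∉ K ∨ ¬ P x) ∩
        (Finset.univ.filter fun x => x ∉ K ∨ P x) = Kᶜ := by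
      ext v
      simp only [Finset.mem_inter, Finset.mem_filter, Finset.mem_univ, true_and,
        Finset.mem_compl]
      tauto
    rw [hunion, hinter, Finset.card_univ, Finset.card_compl] at hsum
    have := K.card_le_univ
    rw [List.length_append, lA, lB]
    omega

/-- Letters occurring once form a clique, so a word for `G` has at least `2 |V| - ω(G)` letters. -/
theorem le_length_of_represents {V : Type*} [Fintype V] [DecidableEq V] {G : SimpleGraph V}
    {k : ℕ} (hk : ∀ s : Finset V, G.IsClique s → s.card ≤ k) {w : List V}
    (hw : Represents G w) : 2 * Fintype.card V - k ≤ w.length := by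
  have hS := hk (Finset.univ.filter fun v => w.count v = 1) (by
    intro a ha b hb hab
    simp only [Finset.coe_filter, Finset.mem_univ, true_and, Set.mem_ofPred_eq] at ha hb
    refine (hw.2 a b hab).2 (alternates_of_nodup_filter ?_)
    rw [List.nodup_iff_count_le_one]
    intro x
    by_cases hx : x = a ∨ x = b
    · refine (List.filter_sublist.count_le x).trans ?_
      rcases hx with rfl | rfl
      · exact ha.le
      · exact hb.le
    · rw [List.count_eq_zero_of_not_mem]
      · exact zero_le_one
      · simp [hx])
  have hsum : ∑ v, w.count v = w.length := by
    simpa using Multiset.sum_count_eq_card (s := Finset.univ) (m := (w : Multiset V)) (by simp)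
  have hle : ∑ _v : V, 2 ≤ ∑ v, (w.count v + if w.count v = 1 then 1 else 0) := by
    refine Finset.sum_le_sum fun v _ => ?_
    have := List.count_pos_iff.2 (hw.1 v)
    split_ifs <;> omega
  rw [Finset.sum_add_distrib, hsum, ← Finset.card_filter, Finset.sum_const, Finset.card_univ,
    smul_eq_mul] at hle
  omega

/-- A finite comparability graph with a universal vertex, all of whose intervals are chains, has a
word in which only the letters outside a given maximal clique are repeated. -/
theorem exists_represents_of_universal {V : Type*} [Fintype V] [DecidableEq V]
    {G : SimpleGraph V} {lt : V → V → Prop}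
    (hlt : IsStrictPO lt) (hadj : ∀ a b, G.Adj a b ↔ (lt a b ∨ lt b a))
    (hint : ∀ r a b x, lt r a → lt a x → lt r b → lt b x → a ≠ b → lt a b ∨ lt b a)
    {r : V} (hr : ∀ v, v ≠ r → G.Adj r v) {K : Finset V} (hK : G.IsClique K)
    (hmax : ∀ x, (∀ y ∈ K, x ≠ y → G.Adj x y) → x ∈ K) :
    ∃ w : List V, Represents G w ∧ w.length = 2 * Fintype.card V - K.card := by
  classical
  obtain ⟨L, M, hL, hM, mL, mM, adj₁, nadj₁, kadj₁, knadj₁⟩ :=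
    exists_realizer_above hlt hadj hint hr hK hmax
  obtain ⟨L', M', hL', hM', mL', mM', adj₂, nadj₂, kadj₂, knadj₂⟩ :=
    exists_realizer_above (lt := fun a b => lt b a) ⟨hlt.1, fun a b c h h' => hlt.2 _ _ _ h' h⟩
      (fun a b => by rw [hadj, or_comm])
      (fun r a b x h₁ h₂ h₃ h₄ hab => (hint x a b r h₂ h₁ h₄ h₃ hab).symm) hr hK hmax
  have hrK : r ∈ K := hmax r fun y _ hy => hr y hy.symm
  have side : ∀ x, lt r x ∨ lt x r ∨ x = r := fun x => by
    by_cases hx : x = r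
    · exact Or.inr (Or.inr hx)
    · exact ((hadj _ _).1 (hr x hx)).imp_right Or.inl
  have side' : ∀ x, x ∉ K → lt r x ∨ lt x r := fun x hx => by
    rcases side x with h | h | rfl
    · exact Or.inl h
    · exact Or.inr h
    · exact absurd hrK hx
  have hirr : ¬ lt r r := hlt.1 r
  have hasymm : ∀ x, lt r x → ¬ lt x r := fun x h h' => hirr (hlt.2 _ _ _ h h')
  have cross : ∀ x y, lt r x → lt y r → G.Adj x y := fun x y hx hy =>
    (hadj _ _).2 (Or.inr (hlt.2 _ _ _ hy hx))
  have nodup : ∀ {A B : List V}, A.Nodup → B.Nodup → (∀ x, x ∈ A ↔ lt r x) →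
      (∀ x, x ∈ B ↔ lt x r) → (A ++ (B.reverse ++ [r])).Nodup := by
    intro A B hA hB mA mB
    simp only [List.nodup_append, List.nodup_reverse, List.mem_append, List.mem_reverse,
      List.nodup_singleton, List.mem_singleton, mA, mB]
    refine ⟨hA, ⟨hB, trivial, ?_⟩, ?_⟩
    · rintro x hx _ rfl rfl
      exact hirr hx
    · rintro x hx _ (hy | rfl) rfl
      · exact hasymm x hx hy
      · exact hirr hx
  have mem : ∀ {A B : List V}, (∀ x, x ∈ A ↔ lt r x) → (∀ x, x ∈ B ↔ lt x r) →
      ∀ x, x ∈ A ++ (B.reverse ++ [r]) := by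
    intro A B mA mB x
    simpa [mA, mB] using side x
  have above : ∀ {x y : V} {A B : List V}, [x, y] <+ A → [x, y] <+ A ++ (B.reverse ++ [r]) :=
    fun h => h.trans (List.sublist_append_left _ _)
  have below : ∀ {x y : V} {A B : List V}, [x, y] <+ B → [y, x] <+ A ++ (B.reverse ++ [r]) :=
    fun h => (h.reverse.trans (List.sublist_append_left _ _)).trans
      (List.sublist_append_right _ _)
  have mixed : ∀ {x y : V} {A B : List V}, (∀ x, x ∈ A ↔ lt r x) → (∀ x, x ∈ B ↔ lt x r) →
      lt r x → lt y r → [x, y] <+ A ++ (B.reverse ++ [r]) := fun mA mB hx hy =>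
    pair_sublist_append ((mA _).2 hx) (by simp [(mB _).2 hy])
  have last : ∀ {x : V} {A B : List V}, (∀ x, x ∈ A ↔ lt r x) → (∀ x, x ∈ B ↔ lt x r) →
      x ≠ r → [x, r] <+ A ++ (B.reverse ++ [r]) := fun {x A B} mA mB hx => by
    rw [← List.append_assoc]
    refine pair_sublist_append ?_ (by simp)
    have := side x
    simp only [List.mem_append, List.mem_reverse, mA, mB]
    tauto
  refine represents_of_realizer hK (lt r) (X := L ++ (M'.reverse ++ [r]))
    (Y := M ++ (L'.reverse ++ [r])) (nodup hL hM' mL mM') (nodup hM hL' mM mL')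
    (mem mL mM') (mem mM mL') ?_ ?_ ?_ ?_ ?_ ?_
  · intro a b ha hb hab
    rcases side' a ha with ha | ha <;> rcases side' b hb with hb | hb
    · exact (adj₁ a b ha hb hab).imp (And.imp above above) (And.imp above above)
    · exact Or.inl ⟨mixed mL mM' ha hb, mixed mM mL' ha hb⟩
    · exact Or.inr ⟨mixed mL mM' hb ha, mixed mM mL' hb ha⟩
    · exact (adj₂ b a hb ha hab.symm).imp (fun h => ⟨below h.2, below h.1⟩)
        (fun h => ⟨below h.2, below h.1⟩)
  · intro a b ha hb hne hab
    rcases side' a ha with ha | ha <;> rcases side' b hb with hb | hb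
    · exact (nadj₁ a b ha hb hne hab).imp (And.imp above above) (And.imp above above)
    · exact absurd (cross a b ha hb) hab
    · exact absurd (cross b a hb ha).symm hab
    · exact (nadj₂ a b ha hb hne hab).imp (fun h => ⟨below h.2, below h.1⟩)
        (fun h => ⟨below h.2, below h.1⟩)
  · intro x c hx hc hP hxc
    rcases (side c).resolve_left hP with hcr | rfl
    · rcases side' x hx with hxr | hxr
      · exact mixed mL mM' hxr hcr
      · exact below (kadj₂ x c hxr hcr hx hc hxc)
    · exact last mL mM' hxc.ne
  · intro x c hx hc hP hxc
    rcases (side c).resolve_left hP with hcr | rfl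
    · rcases side' x hx with hxr | hxr
      · exact absurd (cross x c hxr hcr) hxc
      · exact below (knadj₂ x c hxr hcr hx hc hxc)
    · exact absurd (hr x (by rintro rfl; exact hx hc)).symm hxc
  · intro x c hx hc hP hxc
    rcases side' x hx with hxr | hxr
    · exact above (kadj₁ x c hxr hP hx hc hxc)
    · exact mixed mM mL' hP hxr
  · intro x c hx hc hP hxc
    rcases side' x hx with hxr | hxr
    · exact above (knadj₁ x c hxr hP hx hc hxc)
    · exact absurd (cross c x hP hxr).symm hxc

end

/-- If `G` is a double-arborescence on `n` vertices with clique number `k`, then the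
minimum length of a word representing `G` is `2n - k`. -/
theorem doubleArborescence_min_word_length
    {V : Type*} [Fintype V] [DecidableEq V] (G : SimpleGraph V)
    (hconn : G.Connected) (hG : IsDoubleArborescence G)
    (n k : ℕ) (hn : Fintype.card V = n)
    (hk : IsGreatest {m : ℕ | ∃ s : Finset V, G.IsNClique m s} k) :
    IsLeast {m : ℕ | ∃ w : List V, Represents G w ∧ w.length = m} (2 * n - k) := by
  obtain ⟨⟨lt, hlt, hadj, htree⟩, r, hr⟩ := hG
  obtain ⟨⟨K, hK⟩, hub⟩ := hk
  have hbound : ∀ s : Finset V, G.IsClique s → s.card ≤ k := fun s hs => hub ⟨s, hs, rfl⟩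
  subst hn
  refine ⟨?_, ?_⟩
  · have hmax : ∀ x, (∀ y ∈ K, x ≠ y → G.Adj x y) → x ∈ K := by
      intro x hx
      by_contra hxK
      have h := hbound (insert x K) (by
        rw [Finset.coe_insert]
        exact hK.isClique.insert hx)
      rw [Finset.card_insert_of_notMem hxK, hK.card_eq] at h
      omega
    rw [← hK.card_eq]
    exact exists_represents_of_universal hlt hadj
      (fun r a b x h₁ h₂ h₃ h₄ hab => comparable_of_mem_interval hlt htree h₁ h₂ h₃ h₄ hab)
      hr hK.isClique hmax
  · rintro _ ⟨w, hw, rfl⟩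
    exact le_length_of_represents hbound hw
end
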